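/- arXiv:0808.4134 — 3 statements merged into one kernel-verified Lean document; each statement's English description precedes it below -/
import Mathlib

section
/- There is an absolute constant c such that for every ε ∈ (0,1/2), every p ∈ (0,1/2), and every unweighted graph G = (V,E) with n vertices, there exists a weighted graph G̃ whose edge set is a subset of E, such that G̃ is a (1+ε)-spectral approximation of G and G̃ has at most c·ε^{-2}·n·log^{31}(n/p) edges. -/
/-- The Laplacian quadratic form of a weighted graph given by a symmetric
weight function.  The double sum counts every unordered edge twice, whence the
factor `1/2`. -/
noncomputable def lapQ {n : ℕ} (w : Fin n → Fin n → ℝ) (x : Fin n → ℝ) : ℝ :=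
  (1 / 2) * ∑ u, ∑ v, w u v * (x u - x v) ^ 2

open Matrix

section bss
set_option linter.unusedSectionVars false
variable {ι : Type*} [Fintype ι] [DecidableEq ι]

lemma bss_quad_vec (M : Matrix ι ι ℝ) (v : ι → ℝ) :
    (M * vecMulVec v v).trace = v ⬝ᵥ M *ᵥ v := by
  rw [mul_vecMulVec, trace_vecMulVec, dotProduct_comm]

lemma bss_inv_mul {B : Matrix ι ι ℝ} (hB : B.PosDef) : B⁻¹ * B = 1 :=
  Matrix.nonsing_inv_mul _ ((Matrix.isUnit_iff_isUnit_det _).1 hB.isUnit)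

lemma bss_mul_inv {B : Matrix ι ι ℝ} (hB : B.PosDef) : B * B⁻¹ = 1 :=
  Matrix.mul_nonsing_inv _ ((Matrix.isUnit_iff_isUnit_det _).1 hB.isUnit)

lemma bss_symm {B : Matrix ι ι ℝ} (hB : B.IsHermitian) (x y : ι → ℝ) :
    x ⬝ᵥ B *ᵥ y = y ⬝ᵥ B *ᵥ x := by
  have h : Bᵀ = B := by simpa [IsHermitian] using hB
  conv_lhs => rw [dotProduct_mulVec, ← h, vecMul_transpose, dotProduct_comm]

lemma bss_pos {B : Matrix ι ι ℝ} (hB : B.PosDef) {x : ι → ℝ} (hx : x ≠ 0) :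
    0 < x ⬝ᵥ B *ᵥ x := by simpa using hB.dotProduct_mulVec_pos hx

lemma bss_nonneg {B : Matrix ι ι ℝ} (hB : B.PosSemidef) (x : ι → ℝ) :
    0 ≤ x ⬝ᵥ B *ᵥ x := by simpa using hB.dotProduct_mulVec_nonneg x

lemma bss_cs {B : Matrix ι ι ℝ} (hB : B.PosDef) (v x : ι → ℝ) :
    (v ⬝ᵥ x) ^ 2 ≤ (v ⬝ᵥ B⁻¹ *ᵥ v) * (x ⬝ᵥ B *ᵥ x) := by
  by_cases hv : v = 0
  · simp [hv]
  have hr := bss_pos hB.inv hv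
  set r := v ⬝ᵥ B⁻¹ *ᵥ v with hrd
  have key : ∀ c : ℝ, 0 ≤ x ⬝ᵥ B *ᵥ x - 2 * c * (v ⬝ᵥ x) + c ^ 2 * r := by
    intro c
    have h := bss_nonneg hB.posSemidef (x - c • (B⁻¹ *ᵥ v))
    have h1 : B *ᵥ (B⁻¹ *ᵥ v) = v := by rw [mulVec_mulVec, bss_mul_inv hB, one_mulVec]
    have h2 : (B⁻¹ *ᵥ v) ⬝ᵥ B *ᵥ x = v ⬝ᵥ x := by
      rw [bss_symm hB.isHermitian, h1, dotProduct_comm]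
    rw [mulVec_sub, mulVec_smul, h1, sub_dotProduct, dotProduct_sub, dotProduct_sub,
      smul_dotProduct, smul_dotProduct, dotProduct_smul, dotProduct_smul, h2,
      dotProduct_comm x v, dotProduct_comm (B⁻¹ *ᵥ v) v] at h
    simp only [smul_eq_mul] at h
    rw [← hrd] at h
    linarith
  have h := key ((v ⬝ᵥ x) / r)
  have : x ⬝ᵥ B *ᵥ x - 2 * ((v ⬝ᵥ x) / r) * (v ⬝ᵥ x) + ((v ⬝ᵥ x) / r) ^ 2 * r
    = x ⬝ᵥ B *ᵥ x - (v ⬝ᵥ x)^2 / r := by field_simp; ring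
  rw [this, sub_nonneg, div_le_iff₀ hr] at h
  linarith

lemma bss_quad_add (B : Matrix ι ι ℝ) (c : ℝ) (v x : ι → ℝ) :
    x ⬝ᵥ (B + c • vecMulVec v v) *ᵥ x = x ⬝ᵥ B *ᵥ x + c * (v ⬝ᵥ x) ^ 2 := by
  rw [add_mulVec, dotProduct_add, smul_mulVec, dotProduct_smul, vecMulVec_mulVec]
  simp [dotProduct_comm x v]; ring_nf; simp

lemma bss_herm_vec (v : ι → ℝ) : (vecMulVec v v).IsHermitian := by
  ext i j; simp [vecMulVec, mul_comm]

lemma bss_rank_one {B : Matrix ι ι ℝ} (hB : B.PosDef) (v : ι → ℝ) (c : ℝ)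
    (h : 0 < 1 + c * (v ⬝ᵥ B⁻¹ *ᵥ v)) :
    (B + c • vecMulVec v v).PosDef ∧
    (B + c • vecMulVec v v)⁻¹.trace = B⁻¹.trace -
      c / (1 + c * (v ⬝ᵥ B⁻¹ *ᵥ v)) * (v ⬝ᵥ (B⁻¹ * B⁻¹) *ᵥ v) := by
  constructor
  · refine PosDef.of_dotProduct_mulVec_pos ?_ ?_
    · refine hB.isHermitian.add ?_
      have := bss_herm_vec v
      unfold IsHermitian at *
      rw [conjTranspose_smul, this]; simp
    · intro x hx
      simp only [star_trivial]
      rw [bss_quad_add]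
      have h1 := bss_pos hB hx
      have h2 := bss_cs hB v x
      rcases le_or_gt 0 c with hc | hc
      · positivity
      · nlinarith
  · set k := c / (1 + c * (v ⬝ᵥ B⁻¹ *ᵥ v)) with hk
    have hinv : (B + c • vecMulVec v v)⁻¹ = B⁻¹ - k • (B⁻¹ * vecMulVec v v * B⁻¹) := by
      apply inv_eq_right_inv
      have e1 : vecMulVec v v * B⁻¹ * vecMulVec v v = (v ⬝ᵥ B⁻¹ *ᵥ v) • vecMulVec v v := by
        rw [mul_assoc, mul_vecMulVec, vecMulVec_mul_vecMulVec]
        ext i j; simp [vecMulVec]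
        ring
      have e2 : (B + c • vecMulVec v v) * (B⁻¹ - k • (B⁻¹ * vecMulVec v v * B⁻¹))
        = B * B⁻¹ + c • (vecMulVec v v * B⁻¹) - k • (B * B⁻¹ * vecMulVec v v * B⁻¹)
          - (c * k) • (vecMulVec v v * B⁻¹ * vecMulVec v v * B⁻¹) := by
        rw [mul_comm c k]
        simp only [add_mul, mul_sub, smul_mul_assoc, mul_smul_comm, mul_assoc, smul_smul,
          smul_add]
        abel_nf
      rw [e2, e1, bss_mul_inv hB, one_mul, smul_mul_assoc, smul_smul]
      have e3 : c = k + c * k * (v ⬝ᵥ B⁻¹ *ᵥ v) := by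
        rw [hk]; field_simp
      have e4 : c • (vecMulVec v v * B⁻¹) = k • (vecMulVec v v * B⁻¹) +
          (c * k * (v ⬝ᵥ B⁻¹ *ᵥ v)) • (vecMulVec v v * B⁻¹) := by
        rw [← add_smul, ← e3]
      rw [e4]; abel
    rw [hinv, trace_sub, trace_smul, trace_mul_comm, ← mul_assoc, bss_quad_vec, smul_eq_mul]

lemma bss_shift_pos {B : Matrix ι ι ℝ} (hB : B.PosDef) {δ : ℝ} (hδ : 0 < δ) :
    (B + δ • (1 : Matrix ι ι ℝ)).PosDef :=
  hB.add (PosDef.one.smul hδ)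

/-- Resolvent facts: if `B' = B + δ`, with `Q = B⁻¹`, `R = B'⁻¹`. -/
lemma bss_resolvent {B : Matrix ι ι ℝ} {δ : ℝ} (hB : B.PosDef)
    (hB' : (B + δ • (1 : Matrix ι ι ℝ)).PosDef) :
    B⁻¹ - (B + δ • (1 : Matrix ι ι ℝ))⁻¹ = δ • (B⁻¹ * (B + δ • (1 : Matrix ι ι ℝ))⁻¹) ∧
    B⁻¹ - (B + δ • (1 : Matrix ι ι ℝ))⁻¹ = δ • ((B + δ • (1 : Matrix ι ι ℝ))⁻¹ * B⁻¹) := by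
  set C := B + δ • (1 : Matrix ι ι ℝ) with hC
  have e : C - B = δ • (1 : Matrix ι ι ℝ) := by simp [hC]
  constructor
  · have : B⁻¹ * (C - B) * C⁻¹ = B⁻¹ - C⁻¹ := by
      rw [mul_sub, sub_mul, mul_assoc, bss_mul_inv hB', bss_inv_mul hB]; simp
    rw [← this, e]; simp
  · have : C⁻¹ * (C - B) * B⁻¹ = B⁻¹ - C⁻¹ := by
      rw [mul_sub, sub_mul, bss_inv_mul hB', mul_assoc, bss_mul_inv hB]; simp
    rw [← this, e]; simp

lemma bss_sq_posDef {R : Matrix ι ι ℝ} (hR : R.PosDef) : (R * R).PosDef := by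
  have := PosDef.one (n := ι) (R := ℝ) |>.conjTranspose_mul_mul_same (B := R) (by
    exact mulVec_injective_of_isUnit hR.isUnit)
  rwa [hR.isHermitian.eq, mul_one] at this

lemma bss_conj {Q X : Matrix ι ι ℝ} (hQ : Q.PosSemidef) (hX : X.IsHermitian) :
    0 ≤ (X * Q * X).trace := by
  have := (hQ.conjTranspose_mul_mul_same X).trace_nonneg
  rwa [hX.eq] at this

lemma bss_upper [Nonempty ι] {B : Matrix ι ι ℝ} (hB : B.PosDef) {δ : ℝ} (hδ : 0 < δ) :
    0 < B⁻¹.trace - (B + δ • (1 : Matrix ι ι ℝ))⁻¹.trace ∧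
    δ * ((B + δ • (1 : Matrix ι ι ℝ))⁻¹ * (B + δ • (1 : Matrix ι ι ℝ))⁻¹).trace ≤
      B⁻¹.trace - (B + δ • (1 : Matrix ι ι ℝ))⁻¹.trace := by
  have hC := bss_shift_pos hB hδ
  obtain ⟨h1, h2⟩ := bss_resolvent hB hC
  set R := (B + δ • (1 : Matrix ι ι ℝ))⁻¹ with hR
  have hRp : R.PosDef := hC.inv
  have ht := (bss_sq_posDef hRp).trace_pos
  have h3 : (B⁻¹ * R - R * R) = δ • (R * B⁻¹ * R) := by
    rw [← sub_mul, h2, smul_mul_assoc]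
  have h4 := bss_conj hB.inv.posSemidef hRp.isHermitian
  have h5 := congrArg trace h3
  have h6 := congrArg trace h1
  rw [trace_sub, trace_smul, smul_eq_mul] at h5 h6
  rw [h6]
  have : (R * R).trace ≤ (B⁻¹ * R).trace := by nlinarith
  constructor
  · apply mul_pos hδ; linarith
  · exact mul_le_mul_of_nonneg_left this hδ.le

lemma bss_quad_le_trace {Q : Matrix ι ι ℝ} (hQ : Q.PosSemidef) (x : ι → ℝ) :
    x ⬝ᵥ Q *ᵥ x ≤ Q.trace * (x ⬝ᵥ x) := by
  by_cases hx : x = 0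
  · simp [hx]
  have hp : 0 < x ⬝ᵥ x := by
    have := bss_pos (PosDef.one (n := ι) (R := ℝ)) hx
    simpa using this
  set r := x ⬝ᵥ x with hr
  set P := r • (1 : Matrix ι ι ℝ) - vecMulVec x x with hP
  have hPh : P.IsHermitian := by
    apply IsHermitian.sub _ (bss_herm_vec x)
    unfold IsHermitian; rw [conjTranspose_smul]; simp
  have hvv : vecMulVec x x * vecMulVec x x = r • vecMulVec x x := by
    rw [vecMulVec_mul_vecMulVec]; ext i j; simp [vecMulVec, hr]; ring
  have hPP : P * P = r • P := by
    simp only [hP, sub_mul, mul_sub, hvv]; simp [smul_sub]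
  have h := bss_conj hQ hPh
  rw [trace_mul_comm, ← mul_assoc, hPP, smul_mul_assoc, trace_smul, trace_mul_comm, hP, mul_sub,
    trace_sub, bss_quad_vec, smul_eq_mul] at h
  have h' := nonneg_of_mul_nonneg_right h hp
  simp at h'
  linarith

lemma bss_lower [Nonempty ι] {B : Matrix ι ι ℝ} (hB : B.PosDef) (ht : B⁻¹.trace < 1) :
    (B - 1).PosDef ∧ 0 < (B - 1)⁻¹.trace - B⁻¹.trace ∧
    ((B - 1)⁻¹.trace - B⁻¹.trace) * (1 + ((B - 1)⁻¹.trace - B⁻¹.trace)) ≤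
      ((B - 1)⁻¹ * (B - 1)⁻¹).trace := by
  have hC : (B - 1).PosDef := by
    refine PosDef.of_dotProduct_mulVec_pos (hB.isHermitian.sub isHermitian_one) ?_
    intro x hx
    have hp : 0 < x ⬝ᵥ x := by
      have := bss_pos (PosDef.one (n := ι) (R := ℝ)) hx
      simpa using this
    simp only [star_trivial, sub_mulVec, dotProduct_sub, one_mulVec]
    have h1 := bss_cs hB x x
    have h2 := bss_quad_le_trace hB.inv.posSemidef x
    have h3 := bss_pos hB hx
    have h4 : (x ⬝ᵥ x) ^ 2 ≤ B⁻¹.trace * (x ⬝ᵥ x) * (x ⬝ᵥ B *ᵥ x) :=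
      h1.trans (mul_le_mul_of_nonneg_right h2 h3.le)
    have h5 : x ⬝ᵥ x ≤ B⁻¹.trace * (x ⬝ᵥ B *ᵥ x) := by
      by_contra hcon
      push Not at hcon
      nlinarith
    nlinarith
  refine ⟨hC, ?_⟩
  have hBe : (B - 1) + (1:ℝ) • (1 : Matrix ι ι ℝ) = B := by simp
  have hres := bss_resolvent (B := B - 1) (δ := 1) hC (by rwa [hBe])
  rw [hBe, one_smul, one_smul] at hres
  obtain ⟨h1, h2⟩ := hres
  set R := (B - 1)⁻¹ with hR
  set Q := B⁻¹ with hQ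
  have hRp : R.PosDef := hC.inv
  have hQp : Q.PosDef := hB.inv
  have hq := (bss_sq_posDef hQp).trace_pos
  have h3 : R * Q - Q * Q = Q * R * Q := by rw [← sub_mul, h2]
  have h4 := bss_conj hRp.posSemidef hQp.isHermitian
  have h5 := congrArg trace h3
  have h6 := congrArg trace h1
  rw [trace_sub] at h5 h6
  have h7 : R * R - R * Q = R * Q * R := by rw [← mul_sub, h2, mul_assoc]
  have h8 := congrArg trace h7
  rw [trace_sub] at h8
  set t := (R * Q).trace with htd
  have hXh : (R - t • (1 : Matrix ι ι ℝ)).IsHermitian := by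
    apply hRp.isHermitian.sub
    unfold IsHermitian; rw [conjTranspose_smul]; simp
  have h9 := bss_conj hQp.posSemidef hXh
  have h10 : ((R - t • (1 : Matrix ι ι ℝ)) * Q * (R - t • (1 : Matrix ι ι ℝ))).trace
      = (R * Q * R).trace - 2 * t * t + t ^ 2 * Q.trace := by
    have hc : (Q * R).trace = t := by rw [trace_mul_comm]
    simp only [sub_mul, mul_sub, smul_mul_assoc, mul_smul_comm, one_mul, mul_one, trace_sub,
      trace_smul, smul_eq_mul, hc, ← htd]
    ring
  rw [h10] at h9
  rw [h6]
  refine ⟨by linarith, ?_⟩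
  nlinarith [sq_nonneg t]

variable {κ : Type*} [Fintype κ] [DecidableEq κ]

lemma bss_sum_quad (v : κ → ι → ℝ) (hv : ∑ e, vecMulVec (v e) (v e) = (1 : Matrix ι ι ℝ))
    (M : Matrix ι ι ℝ) : ∑ e, v e ⬝ᵥ M *ᵥ v e = M.trace := by
  simp_rw [← bss_quad_vec]
  rw [← trace_sum, ← Finset.mul_sum, hv, mul_one]

lemma bss_step [Nonempty ι] (v : κ → ι → ℝ)
    (hv : ∑ e, vecMulVec (v e) (v e) = (1 : Matrix ι ι ℝ))
    {η δ : ℝ} (hη : η < 1) (hδ : 0 < δ) (hηδ : 1 / δ + η < 1 - η)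
    {BU BL : Matrix ι ι ℝ} (hU : BU.PosDef) (hL : BL.PosDef)
    (hUt : BU⁻¹.trace ≤ η) (hLt : BL⁻¹.trace ≤ η) :
    ∃ (e : κ) (t : ℝ), 0 < t ∧
      (BU + δ • (1 : Matrix ι ι ℝ) + (-t) • vecMulVec (v e) (v e)).PosDef ∧
      (BU + δ • (1 : Matrix ι ι ℝ) + (-t) • vecMulVec (v e) (v e))⁻¹.trace ≤ η ∧
      (BL - 1 + t • vecMulVec (v e) (v e)).PosDef ∧
      (BL - 1 + t • vecMulVec (v e) (v e))⁻¹.trace ≤ η := by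
  obtain ⟨ha, hua⟩ := bss_upper hU hδ
  have hCU := bss_shift_pos hU hδ
  obtain ⟨hCL, hb, hlb⟩ := bss_lower hL (hLt.trans_lt hη)
  set CU := BU + δ • (1 : Matrix ι ι ℝ)
  set CL := BL - 1
  set a := BU⁻¹.trace - CU⁻¹.trace with had
  set b := CL⁻¹.trace - BL⁻¹.trace with hbd
  have hlt : ∑ e, ((v e ⬝ᵥ (CU⁻¹ * CU⁻¹) *ᵥ v e) / a + v e ⬝ᵥ CU⁻¹ *ᵥ v e) <
      ∑ e, ((v e ⬝ᵥ (CL⁻¹ * CL⁻¹) *ᵥ v e) / b - v e ⬝ᵥ CL⁻¹ *ᵥ v e) := by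
    rw [Finset.sum_add_distrib, Finset.sum_sub_distrib, ← Finset.sum_div, ← Finset.sum_div,
      bss_sum_quad v hv, bss_sum_quad v hv, bss_sum_quad v hv, bss_sum_quad v hv]
    have h1 : (CU⁻¹ * CU⁻¹).trace / a ≤ 1 / δ := by
      rw [div_le_div_iff₀ ha hδ]; linarith
    have h2 : 1 + b ≤ (CL⁻¹ * CL⁻¹).trace / b := by
      rw [le_div_iff₀ hb]; linarith
    linarith
  obtain ⟨e, -, he⟩ := Finset.exists_lt_of_sum_lt hlt
  have p1 := bss_nonneg (bss_sq_posDef hCU.inv).posSemidef (v e)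
  have p2 := bss_nonneg hCU.inv.posSemidef (v e)
  have p3 := bss_nonneg (bss_sq_posDef hCL.inv).posSemidef (v e)
  have p4 := bss_nonneg hCL.inv.posSemidef (v e)
  have RU := bss_rank_one hCU (v e)
  have RL := bss_rank_one hCL (v e)
  set x := v e ⬝ᵥ (CU⁻¹ * CU⁻¹) *ᵥ v e
  set y := v e ⬝ᵥ CU⁻¹ *ᵥ v e
  set z := v e ⬝ᵥ (CL⁻¹ * CL⁻¹) *ᵥ v e
  set w := v e ⬝ᵥ CL⁻¹ *ᵥ v e
  set l := z / b - w with hl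
  have hxa : 0 ≤ x / a := by positivity
  have hl0 : 0 < l := by linarith
  have hU1 : 0 < 1 + (-(1 / l)) * y := by
    have : 1 + (-(1 / l)) * y = (l - y) / l := by field_simp; ring
    rw [this]; apply div_pos _ hl0; linarith
  have hL1 : 0 < 1 + (1 / l) * w := by positivity
  obtain ⟨u1, u2⟩ := RU _ hU1
  obtain ⟨l1, l2⟩ := RL _ hL1
  refine ⟨e, 1 / l, by positivity, u1, ?_, l1, ?_⟩
  · rw [u2]
    have h1 : -(1 / l) / (1 + -(1 / l) * y) * x = - (x / (l - y)) := by
      have : 1 + (-(1 / l)) * y = (l - y) / l := by field_simp; ring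
      rw [this]
      have : l - y ≠ 0 := by linarith
      field_simp
    rw [h1]
    have h2 : x / (l - y) ≤ a := by
      rw [div_le_iff₀ (by linarith)]
      have : x / a ≤ l - y := by linarith
      rw [div_le_iff₀ ha] at this
      linarith
    linarith
  · rw [l2]
    have h1 : 1 / l / (1 + 1 / l * w) * z = z / (l + w) := by
      field_simp
    rw [h1]
    have h2 : z / (l + w) = b := by
      have : l + w = z / b := by rw [hl]; ring
      have hz : 0 < z / b := by rw [← this]; linarith
      have hz' : z ≠ 0 := by rintro h; simp [h] at hz
      rw [this]; field_simp
    linarith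


lemma bss_iter [Nonempty ι] (v : κ → ι → ℝ)
    (hv : ∑ e, vecMulVec (v e) (v e) = (1 : Matrix ι ι ℝ))
    {η δ : ℝ} (hη0 : 0 < η) (hη : η < 1) (hδ : 0 < δ) (hηδ : 1 / δ + η < 1 - η) (q : ℕ) :
    ∃ s : κ → ℝ, (∀ e, 0 ≤ s e) ∧ (Finset.univ.filter fun e => s e ≠ 0).card ≤ q ∧
      ((Fintype.card ι / η + q * δ) • (1 : Matrix ι ι ℝ)
        - ∑ e, s e • vecMulVec (v e) (v e)).PosDef ∧
      ((Fintype.card ι / η + q * δ) • (1 : Matrix ι ι ℝ)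
        - ∑ e, s e • vecMulVec (v e) (v e))⁻¹.trace ≤ η ∧
      (∑ e, s e • vecMulVec (v e) (v e)
        - (q - Fintype.card ι / η) • (1 : Matrix ι ι ℝ)).PosDef ∧
      (∑ e, s e • vecMulVec (v e) (v e)
        - (q - Fintype.card ι / η) • (1 : Matrix ι ι ℝ))⁻¹.trace ≤ η := by
  induction q with
  | zero =>
    have hd : (0 : ℝ) < Fintype.card ι := by exact_mod_cast Fintype.card_pos
    have hr : (0 : ℝ) < Fintype.card ι / η := by positivity
    have hp : (((Fintype.card ι : ℝ) / η) • (1 : Matrix ι ι ℝ)).PosDef := PosDef.one.smul hr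
    have ht : (((Fintype.card ι : ℝ) / η) • (1 : Matrix ι ι ℝ))⁻¹.trace ≤ η := by
      have : (((Fintype.card ι : ℝ) / η) • (1 : Matrix ι ι ℝ))⁻¹
          = (η / (Fintype.card ι : ℝ)) • (1 : Matrix ι ι ℝ) := by
        apply inv_eq_right_inv
        rw [smul_mul_smul_comm, one_mul]
        have : (Fintype.card ι : ℝ) / η * (η / (Fintype.card ι : ℝ)) = 1 := by field_simp
        rw [this, one_smul]
      rw [this, trace_smul, trace_one, smul_eq_mul]
      apply le_of_eq; field_simp
    refine ⟨fun _ => 0, by simp, by simp, ?_, ?_, ?_, ?_⟩ <;> simpa using by assumption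
  | succ q ih =>
    obtain ⟨s, hs, hc, hU, hUt, hL, hLt⟩ := ih
    obtain ⟨e, t, ht, u1, u2, l1, l2⟩ := bss_step v hv hη hδ hηδ hU hL hUt hLt
    have hsum : ∑ e', (s e' + if e' = e then t else 0) • vecMulVec (v e') (v e')
        = ∑ e', s e' • vecMulVec (v e') (v e') + t • vecMulVec (v e) (v e) := by
      simp [add_smul, Finset.sum_add_distrib, ite_smul]
    have eU : (Fintype.card ι / η + (q + 1 : ℕ) * δ) • (1 : Matrix ι ι ℝ)
        - ∑ e', (s e' + if e' = e then t else 0) • vecMulVec (v e') (v e')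
        = (Fintype.card ι / η + q * δ) • (1 : Matrix ι ι ℝ)
          - ∑ e', s e' • vecMulVec (v e') (v e')
          + δ • (1 : Matrix ι ι ℝ) + (-t) • vecMulVec (v e) (v e) := by
      rw [hsum]; push_cast; module
    have eL : ∑ e', (s e' + if e' = e then t else 0) • vecMulVec (v e') (v e')
          - ((q + 1 : ℕ) - Fintype.card ι / η) • (1 : Matrix ι ι ℝ)
        = ∑ e', s e' • vecMulVec (v e') (v e') - (q - Fintype.card ι / η) • (1 : Matrix ι ι ℝ)
          - 1 + t • vecMulVec (v e) (v e) := by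
      rw [hsum]; push_cast; module
    refine ⟨fun e' => s e' + if e' = e then t else 0, ?_, ?_, ?_, ?_, ?_, ?_⟩
    · intro e'
      have := hs e'
      dsimp only
      split_ifs <;> linarith
    · refine le_trans (Finset.card_le_card (t := insert e (Finset.univ.filter fun e => s e ≠ 0)) ?_)
        ((Finset.card_insert_le _ _).trans (by omega))
      intro e' he'
      simp only [Finset.mem_filter, Finset.mem_univ, true_and, Finset.mem_insert] at he' ⊢
      by_contra hcon
      push Not at hcon
      simp [hcon.1, hcon.2] at he'
    · rw [eU]; exact u1
    · rw [eU]; exact u2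
    · rw [eL]; exact l1
    · rw [eL]; exact l2

lemma bss_quad_sum (v : κ → ι → ℝ) (s : κ → ℝ) (y : ι → ℝ) :
    y ⬝ᵥ (∑ e, s e • vecMulVec (v e) (v e)) *ᵥ y = ∑ e, s e * (v e ⬝ᵥ y) ^ 2 := by
  rw [sum_mulVec, dotProduct_sum]
  refine Finset.sum_congr rfl fun e _ => ?_
  have := bss_quad_add 0 (s e) (v e) y
  simpa using this

lemma bss_isotropic (v : κ → ι → ℝ)
    (hv : ∑ e, vecMulVec (v e) (v e) = (1 : Matrix ι ι ℝ))
    {ε : ℝ} (h0 : 0 < ε) (h1 : ε < 1 / 2) :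
    ∃ s : κ → ℝ, (∀ e, 0 ≤ s e) ∧
      ((Finset.univ.filter fun e => s e ≠ 0).card : ℝ) ≤ 800 * Fintype.card ι * ε⁻¹ ^ 2 ∧
      ∀ y : ι → ℝ, y ⬝ᵥ y ≤ ∑ e, s e * (v e ⬝ᵥ y) ^ 2 ∧
        ∑ e, s e * (v e ⬝ᵥ y) ^ 2 ≤ (1 + ε) * (y ⬝ᵥ y) := by
  rcases isEmpty_or_nonempty ι with hι | hι
  · refine ⟨fun _ => 0, by simp, by simp, fun y => by simp⟩
  have hd : (1 : ℝ) ≤ Fintype.card ι := by exact_mod_cast Fintype.card_pos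
  set d : ℝ := (Fintype.card ι : ℝ) with hdd
  obtain ⟨η, hη⟩ : ∃ η, η = ε / 20 := ⟨_, rfl⟩
  have hη0 : 0 < η := by linarith
  have hη1 : η < 1 / 40 := by linarith
  have hδ : 0 < 1 / (1 - 3 * η) := by apply div_pos <;> linarith
  obtain ⟨s, hs, hc, hU, -, hL, -⟩ := bss_iter v hv hη0 (by linarith) hδ
    (by rw [one_div_one_div]; linarith) ⌈d / η ^ 2⌉₊
  rw [← hdd] at hU hL
  have hN1 := Nat.le_ceil (d / η ^ 2)
  have hN2 := (Nat.ceil_lt_add_one (a := d / η ^ 2) (by positivity)).le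
  set N : ℝ := (⌈d / η ^ 2⌉₊ : ℝ) with hN
  have hdN : d / η ≤ η * N := by
    rw [div_le_iff₀ (by positivity)] at hN1
    rw [div_le_iff₀ hη0]; linarith
  have hN0 : 0 < N := lt_of_lt_of_le (by positivity) hN1
  set l := N - d / η with hl
  set u := d / η + N * (1 / (1 - 3 * η)) with hu
  have hl0 : 0 < l := by nlinarith
  have hul : u ≤ (1 + ε) * l := by
    have : 1 / (1 - 3 * η) ≤ 1 + 6 * η := by
      rw [div_le_iff₀ (by linarith)]; nlinarith
    have h2 : u ≤ η * N + N * (1 + 6 * η) := by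
      have := mul_le_mul_of_nonneg_left this hN0.le
      linarith
    have h3 : N * (1 - η) ≤ l := by linarith
    have h4 : (1 + ε) * (N * (1 - η)) ≤ (1 + ε) * l :=
      mul_le_mul_of_nonneg_left h3 (by linarith)
    have h5 : ε = 20 * η := by linarith
    have h6 : 1 + 7 * η ≤ (1 + ε) * (1 - η) := by rw [h5]; nlinarith
    have h7 := mul_le_mul_of_nonneg_left h6 hN0.le
    linarith
  refine ⟨fun e => s e / l, fun e => div_nonneg (hs e) hl0.le, ?_, ?_⟩
  · have hcc : (Finset.univ.filter fun e => s e / l ≠ 0) = Finset.univ.filter fun e => s e ≠ 0 := by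
      ext e; simp [hl0.ne']
    rw [hcc]
    have h1 : ((Finset.univ.filter fun e => s e ≠ 0).card : ℝ) ≤ N := by
      rw [hN]; exact_mod_cast hc
    have h2 : d / η ^ 2 = 400 * d * ε⁻¹ ^ 2 := by
      rw [hη]; field_simp; norm_num
    have h3 : (1 : ℝ) ≤ d / η ^ 2 := by
      rw [le_div_iff₀ (by positivity)]; nlinarith
    linarith
  · intro y
    have e1 : ∑ e, s e / l * (v e ⬝ᵥ y) ^ 2 = (∑ e, s e * (v e ⬝ᵥ y) ^ 2) / l := by
      rw [Finset.sum_div]; exact Finset.sum_congr rfl fun e _ => by ring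
    have q1 := bss_nonneg hU.posSemidef y
    have q2 := bss_nonneg hL.posSemidef y
    rw [sub_mulVec, dotProduct_sub, bss_quad_sum, smul_mulVec, one_mulVec, dotProduct_smul,
      smul_eq_mul] at q1 q2
    have hy : 0 ≤ y ⬝ᵥ y := by
      have := bss_nonneg (PosSemidef.one (n := ι) (R := ℝ)) y
      simpa using this
    rw [e1]
    constructor
    · rw [le_div_iff₀ hl0]; linarith
    · rw [div_le_iff₀ hl0]
      have := mul_le_mul_of_nonneg_right hul hy
      linarith

lemma bss_general (b : κ → ι → ℝ) {ε : ℝ} (h0 : 0 < ε) (h1 : ε < 1 / 2) :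
    ∃ s : κ → ℝ, (∀ e, 0 ≤ s e) ∧
      ((Finset.univ.filter fun e => s e ≠ 0).card : ℝ) ≤ 800 * Fintype.card ι * ε⁻¹ ^ 2 ∧
      ∀ x : ι → ℝ, ∑ e, (b e ⬝ᵥ x) ^ 2 ≤ ∑ e, s e * (b e ⬝ᵥ x) ^ 2 ∧
        ∑ e, s e * (b e ⬝ᵥ x) ^ 2 ≤ (1 + ε) * ∑ e, (b e ⬝ᵥ x) ^ 2 := by
  set L : Matrix ι ι ℝ := ∑ e, vecMulVec (b e) (b e) with hLd
  have hLh : L.IsHermitian := by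
    unfold IsHermitian
    rw [hLd, conjTranspose_sum]
    exact Finset.sum_congr rfl fun e _ => bss_herm_vec (b e)
  set f : ι → ι → ℝ := fun i => ⇑(hLh.eigenvectorBasis i) with hf
  set lam := hLh.eigenvalues with hlam
  have hLf : ∀ i, L *ᵥ f i = lam i • f i := fun i => hLh.mulVec_eigenvectorBasis i
  have horth : ∀ i j, f i ⬝ᵥ f j = if i = j then 1 else 0 := by
    intro i j
    have := orthonormal_iff_ite.1 hLh.eigenvectorBasis.orthonormal i j
    rw [← this, EuclideanSpace.inner_eq_star_dotProduct, star_trivial, dotProduct_comm]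
  have hexp : ∀ x : ι → ℝ, x = ∑ i, (f i ⬝ᵥ x) • f i := by
    intro x
    have := hLh.eigenvectorBasis.sum_repr' (WithLp.toLp 2 x)
    have h2 := congrArg (fun z : EuclideanSpace ℝ ι => (z : ι → ℝ)) this
    simp only [EuclideanSpace.inner_eq_star_dotProduct, star_trivial] at h2
    refine h2.symm.trans ?_
    ext k
    simp [hf, dotProduct_comm x]
  have hbil : ∀ x y : ι → ℝ, x ⬝ᵥ L *ᵥ y = ∑ e, (b e ⬝ᵥ x) * (b e ⬝ᵥ y) := by
    intro x y
    rw [hLd, sum_mulVec, dotProduct_sum]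
    refine Finset.sum_congr rfl fun e _ => ?_
    rw [vecMulVec_mulVec]
    simp [dotProduct_comm x, mul_comm]
  have hff : ∀ i j, ∑ e, (b e ⬝ᵥ f i) * (b e ⬝ᵥ f j) = if i = j then lam j else 0 := by
    intro i j
    rw [← hbil, hLf, dotProduct_smul, horth]; simp
  have hlam0 : ∀ i, 0 ≤ lam i := by
    intro i
    have := hff i i
    rw [if_pos rfl] at this
    rw [← this]
    exact Finset.sum_nonneg fun e _ => mul_self_nonneg _
  have hz : ∀ i, ¬ 0 < lam i → ∀ e, b e ⬝ᵥ f i = 0 := by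
    intro i hi e
    have h := hff i i
    rw [if_pos rfl, le_antisymm (not_lt.1 hi) (hlam0 i),
      Finset.sum_eq_zero_iff_of_nonneg (fun e _ => mul_self_nonneg _)] at h
    exact mul_self_eq_zero.1 (h e (Finset.mem_univ _))
  set v : κ → {i // 0 < lam i} → ℝ := fun e i => (b e ⬝ᵥ f i) / √(lam i) with hvd
  have hv : ∑ e, vecMulVec (v e) (v e) = (1 : Matrix {i // 0 < lam i} {i // 0 < lam i} ℝ) := by
    ext i j
    rw [Matrix.sum_apply]
    have : ∀ e, vecMulVec (v e) (v e) i j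
        = (b e ⬝ᵥ f i) * (b e ⬝ᵥ f j) / (√(lam i) * √(lam j)) := by
      intro e; simp only [vecMulVec_apply, hvd]; rw [div_mul_div_comm]
    simp_rw [this]
    rw [← Finset.sum_div, hff, Matrix.one_apply]
    by_cases hij : i = j
    · subst hij
      rw [if_pos rfl, if_pos rfl, Real.mul_self_sqrt i.2.le, div_self i.2.ne']
    · rw [if_neg hij, if_neg (fun h => hij (Subtype.ext h)), zero_div]
  obtain ⟨s, hs, hc, hq⟩ := bss_isotropic v hv h0 h1
  refine ⟨s, hs, hc.trans ?_, ?_⟩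
  · have : (Fintype.card {i // 0 < lam i} : ℝ) ≤ Fintype.card ι := by
      exact_mod_cast Fintype.card_subtype_le _
    gcongr
  · intro x
    set y : {i // 0 < lam i} → ℝ := fun i => √(lam i) * (f i ⬝ᵥ x) with hy
    have hbv : ∀ e, b e ⬝ᵥ x = v e ⬝ᵥ y := by
      intro e
      have e1 : b e ⬝ᵥ x = ∑ i, (f i ⬝ᵥ x) * (b e ⬝ᵥ f i) := by
        conv_lhs => rw [hexp x]
        rw [dotProduct_sum]
        exact Finset.sum_congr rfl fun i _ => by rw [dotProduct_smul, smul_eq_mul]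
      have e2 : v e ⬝ᵥ y = ∑ i : {i // 0 < lam i}, (f i ⬝ᵥ x) * (b e ⬝ᵥ f i) := by
        simp only [dotProduct, hvd, hy]
        refine Finset.sum_congr rfl fun i _ => ?_
        have := (Real.sqrt_pos.2 i.2).ne'
        field_simp
      rw [e1, e2, ← Finset.sum_filter_add_sum_filter_not Finset.univ (fun i => 0 < lam i)]
      have e3 : ∑ i ∈ Finset.univ.filter (fun i => ¬ 0 < lam i), (f i ⬝ᵥ x) * (b e ⬝ᵥ f i) = 0 :=
        Finset.sum_eq_zero fun i hi => by rw [hz i (Finset.mem_filter.1 hi).2 e, mul_zero]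
      rw [e3, add_zero]
      exact Finset.sum_subtype _ (by simp) _
    have hyy : y ⬝ᵥ y = ∑ e, (v e ⬝ᵥ y) ^ 2 := by
      have := bss_quad_sum v (fun _ => 1) y
      simp only [one_smul, one_mul] at this
      rw [← this, hv, one_mulVec]
    simp_rw [hbv]
    rw [← hyy]
    exact hq y

end bss


lemma lapQ_symm_eq {n : ℕ} (g : Fin n → Fin n → ℝ) (x : Fin n → ℝ) :
    lapQ (fun u v => g u v + g v u) x = ∑ u, ∑ v, g u v * (x u - x v) ^ 2 := by
  unfold lapQ
  simp only [add_mul, Finset.sum_add_distrib]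
  have : ∑ u, ∑ v, g v u * (x u - x v) ^ 2 = ∑ u, ∑ v, g u v * (x u - x v) ^ 2 := by
    rw [Finset.sum_comm]
    exact Finset.sum_congr rfl fun u _ => Finset.sum_congr rfl fun v _ => by ring
  rw [this]; ring

/--
**existence of spectral sparsifiers of unweighted graphs.**
There is an absolute constant `c` such that for every `ε ∈ (0,1/2)`,
`p ∈ (0,1/2)`, and unweighted graph `G` on `n` vertices, there exists a
weighted graph `G̃` whose edges form a subset of the edges of `G`, such that
`G̃` is a `(1+ε)`-spectral approximation of `G` and `G̃` has at most
`c · ε⁻² · n · log₂³¹(n/p)` edges.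
-/
theorem stmt15 :
    ∃ c : ℝ, 0 < c ∧
      ∀ (n : ℕ) (ε p : ℝ), 0 < ε → ε < 1 / 2 → 0 < p → p < 1 / 2 →
      ∀ (G : SimpleGraph (Fin n)) [DecidableRel G.Adj],
        ∃ wt : Fin n → Fin n → ℝ,
          (∀ u v, wt u v = wt v u) ∧ (∀ u v, 0 ≤ wt u v) ∧
          (∀ u v, wt u v ≠ 0 → G.Adj u v) ∧
          (∀ x : Fin n → ℝ,
            (1 / (1 + ε)) * lapQ wt x ≤
                lapQ (fun u v => if G.Adj u v then (1 : ℝ) else 0) x ∧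
              lapQ (fun u v => if G.Adj u v then (1 : ℝ) else 0) x ≤
                (1 + ε) * lapQ wt x) ∧
          ((Finset.univ.filter fun e : Fin n × Fin n =>
              e.1 < e.2 ∧ wt e.1 e.2 ≠ 0).card : ℝ) ≤
            c * ε⁻¹ ^ 2 * (n : ℝ) * Real.logb 2 ((n : ℝ) / p) ^ 31 := by
  refine ⟨800, by norm_num, ?_⟩
  intro n ε p h0 h1 hp0 hp1 G _
  set b : Fin n × Fin n → Fin n → ℝ := fun e =>
    if e.1 < e.2 ∧ G.Adj e.1 e.2 then Pi.single e.1 1 - Pi.single e.2 1 else 0 with hb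
  obtain ⟨s, hs, hc, hq⟩ := bss_general b h0 h1
  set g : Fin n → Fin n → ℝ := fun u v => if u < v ∧ G.Adj u v then s (u, v) else 0 with hg
  have hg0 : ∀ u v, 0 ≤ g u v := by
    intro u v; simp only [hg]; split_ifs
    · exact hs _
    · exact le_rfl
  have hgadj : ∀ u v, ¬ G.Adj u v → g u v = 0 := by
    intro u v h; simp [hg, h]
  have hbx : ∀ (e : Fin n × Fin n) (x : Fin n → ℝ), b e ⬝ᵥ x =
      if e.1 < e.2 ∧ G.Adj e.1 e.2 then x e.1 - x e.2 else 0 := by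
    intro e x; simp only [hb]; split_ifs
    · simp [sub_dotProduct]
    · simp
  have hwt : ∀ x, lapQ (fun u v => g u v + g v u) x = ∑ e, s e * (b e ⬝ᵥ x) ^ 2 := by
    intro x
    rw [lapQ_symm_eq, Fintype.sum_prod_type]
    refine Finset.sum_congr rfl fun u _ => Finset.sum_congr rfl fun v _ => ?_
    rw [hbx]; simp only [hg]; split_ifs <;> simp
  have hG : ∀ x, lapQ (fun u v => if G.Adj u v then (1 : ℝ) else 0) x = ∑ e, (b e ⬝ᵥ x) ^ 2 := by
    intro x
    have : (fun u v => if G.Adj u v then (1 : ℝ) else 0) =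
        fun u v => (if u < v ∧ G.Adj u v then (1 : ℝ) else 0) +
          (if v < u ∧ G.Adj v u then (1 : ℝ) else 0) := by
      ext u v
      by_cases h : G.Adj u v
      · have h' := h.symm
        rcases lt_or_gt_of_ne h.ne with hlt | hlt
        · simp [h, hlt, hlt.not_gt]
        · simp [h, h', hlt, hlt.not_gt]
      · have h' : ¬ G.Adj v u := fun h' => h h'.symm
        simp [h, h']
    rw [this, lapQ_symm_eq (fun u v => if u < v ∧ G.Adj u v then (1 : ℝ) else 0),
      Fintype.sum_prod_type]
    refine Finset.sum_congr rfl fun u _ => Finset.sum_congr rfl fun v _ => ?_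
    rw [hbx]; dsimp only; split_ifs <;> simp
  refine ⟨fun u v => g u v + g v u, fun u v => add_comm _ _, fun u v => add_nonneg (hg0 _ _) (hg0 _ _),
    ?_, ?_, ?_⟩
  · intro u v h
    by_contra hcon
    exact h (by dsimp only; rw [hgadj u v hcon, hgadj v u fun h' => hcon h'.symm, add_zero])
  · intro x
    rw [hwt, hG]
    obtain ⟨q1, q2⟩ := hq x
    constructor
    · rw [one_div, inv_mul_le_iff₀ (by linarith)]; exact q2
    · have : 0 ≤ ∑ e, s e * (b e ⬝ᵥ x) ^ 2 :=
        Finset.sum_nonneg fun e _ => mul_nonneg (hs e) (sq_nonneg _)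
      nlinarith
  · have hcard : ((Finset.univ.filter fun e : Fin n × Fin n =>
        e.1 < e.2 ∧ g e.1 e.2 + g e.2 e.1 ≠ 0).card : ℝ) ≤ 800 * n * ε⁻¹ ^ 2 := by
      refine le_trans ?_ (by simpa using hc)
      norm_cast
      apply Finset.card_le_card
      intro e he
      simp only [Finset.mem_filter, Finset.mem_univ, true_and] at he ⊢
      obtain ⟨hlt, hne⟩ := he
      intro hse
      apply hne
      simp [hg, hlt.not_gt, hse]
    refine hcard.trans ?_
    rcases Nat.eq_zero_or_pos n with hn | hn
    · simp [hn]
    · have hn1 : (1 : ℝ) ≤ n := by exact_mod_cast hn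
      have hlog : 1 ≤ Real.logb 2 ((n : ℝ) / p) := by
        rw [Real.le_logb_iff_rpow_le (by norm_num) (by positivity), Real.rpow_one,
          le_div_iff₀ hp0]
        linarith
      have h31 : 1 ≤ Real.logb 2 ((n : ℝ) / p) ^ 31 := one_le_pow₀ hlog
      have hpos : 0 ≤ 800 * ε⁻¹ ^ 2 * (n : ℝ) := by positivity
      calc 800 * (n : ℝ) * ε⁻¹ ^ 2 = 800 * ε⁻¹ ^ 2 * (n : ℝ) * 1 := by ring
        _ ≤ _ := mul_le_mul_of_nonneg_left h31 hpos
end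

section
/- There is an absolute constant c such that for every ε ∈ (0,1/2), every p ∈ (0,1/2), every integer U ≥ 2, and every weighted graph G = (V,E,w) with n vertices whose edge weights are integers in {1, …, U−1}, there exists a weighted graph G̃ whose edge set is a subset of E, such that G̃ is a (1+ε)-spectral approximation of G and G̃ has at most c·ε^{-2}·n·(log U)·log^{31}(n/p) edges. -/
namespace BSS
open Matrix

variable {k : ℕ}

lemma pd_pos {M : Matrix (Fin k) (Fin k) ℝ} (hM : M.PosDef) {x : Fin k → ℝ} (hx : x ≠ 0) :
    0 < x ⬝ᵥ M *ᵥ x := by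
  simpa using hM.dotProduct_mulVec_pos hx

lemma psd_nonneg {M : Matrix (Fin k) (Fin k) ℝ} (hM : M.PosSemidef) (x : Fin k → ℝ) :
    0 ≤ x ⬝ᵥ M *ᵥ x := by
  simpa using hM.dotProduct_mulVec_nonneg x

lemma pd_of {M : Matrix (Fin k) (Fin k) ℝ} (hs : Mᵀ = M)
    (h : ∀ x : Fin k → ℝ, x ≠ 0 → 0 < x ⬝ᵥ M *ᵥ x) : M.PosDef := by
  refine PosDef.of_dotProduct_mulVec_pos (by rw [IsHermitian, conjTranspose_eq_transpose_of_trivial, hs]) ?_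
  intro x hx
  simpa using h x hx

lemma pd_symm {M : Matrix (Fin k) (Fin k) ℝ} (hM : M.PosDef) : Mᵀ = M := by
  have := hM.isHermitian
  rwa [IsHermitian, conjTranspose_eq_transpose_of_trivial] at this

lemma pd_mul_inv {M : Matrix (Fin k) (Fin k) ℝ} (hM : M.PosDef) : M * M⁻¹ = 1 :=
  mul_nonsing_inv M ((isUnit_iff_isUnit_det M).1 hM.isUnit)

lemma pd_inv_mul {M : Matrix (Fin k) (Fin k) ℝ} (hM : M.PosDef) : M⁻¹ * M = 1 :=
  nonsing_inv_mul M ((isUnit_iff_isUnit_det M).1 hM.isUnit)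

lemma symm_dot {M : Matrix (Fin k) (Fin k) ℝ} (hM : Mᵀ = M) (x y : Fin k → ℝ) :
    x ⬝ᵥ M *ᵥ y = (M *ᵥ x) ⬝ᵥ y := by
  rw [dotProduct_mulVec, ← mulVec_transpose, hM]

lemma cs {M : Matrix (Fin k) (Fin k) ℝ} (hM : M.PosDef) (v x : Fin k → ℝ) :
    (v ⬝ᵥ x) ^ 2 ≤ (v ⬝ᵥ M⁻¹ *ᵥ v) * (x ⬝ᵥ M *ᵥ x) := by
  have key : ∀ s : ℝ, 0 ≤ (v ⬝ᵥ M⁻¹ *ᵥ v) * (s * s) + (-2 * (v ⬝ᵥ x)) * s + x ⬝ᵥ M *ᵥ x := by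
    intro s
    have h := psd_nonneg hM.posSemidef (x - s • (M⁻¹ *ᵥ v))
    have h2 : M *ᵥ (M⁻¹ *ᵥ v) = v := by rw [mulVec_mulVec, pd_mul_inv hM, one_mulVec]
    have h3 : (M⁻¹ *ᵥ v) ⬝ᵥ (M *ᵥ x) = v ⬝ᵥ x := by
      rw [symm_dot (pd_symm hM), h2]
    rw [mulVec_sub, mulVec_smul, h2] at h
    simp only [sub_dotProduct, dotProduct_sub, smul_dotProduct, dotProduct_smul, smul_eq_mul,
      h3] at h
    rw [dotProduct_comm (M⁻¹ *ᵥ v) v, dotProduct_comm x v] at h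
    linarith
  have := discrim_le_zero key
  unfold discrim at this
  nlinarith

/-- rank-one update stays positive definite. -/
lemma pd_update {M : Matrix (Fin k) (Fin k) ℝ} (hM : M.PosDef) (v : Fin k → ℝ) (t : ℝ)
    (ht : 0 < 1 + t * (v ⬝ᵥ M⁻¹ *ᵥ v)) : (M + t • vecMulVec v v).PosDef := by
  apply pd_of
  · rw [transpose_add, transpose_smul, transpose_vecMulVec, pd_symm hM]
  · intro x hx
    have h1 := pd_pos hM hx
    have h2 := cs hM v x
    have h3 : x ⬝ᵥ (M + t • vecMulVec v v) *ᵥ x = x ⬝ᵥ M *ᵥ x + t * (v ⬝ᵥ x) ^ 2 := by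
      rw [add_mulVec, smul_mulVec, vecMulVec_mulVec, dotProduct_add, dotProduct_smul]
      simp [dotProduct_comm x v]
      ring_nf
      simp
    rw [h3]
    rcases le_total 0 t with h | h
    · positivity
    · nlinarith [mul_pos ht h1, mul_le_mul_of_nonpos_left h2 h]

lemma trace_update {M : Matrix (Fin k) (Fin k) ℝ} (hM : M.PosDef) (v : Fin k → ℝ) (t : ℝ)
    (ht : 0 < 1 + t * (v ⬝ᵥ M⁻¹ *ᵥ v)) :
    trace (M + t • vecMulVec v v)⁻¹ =
      trace M⁻¹ - t * (v ⬝ᵥ (M⁻¹ * M⁻¹) *ᵥ v) / (1 + t * (v ⬝ᵥ M⁻¹ *ᵥ v)) := by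
  set q := v ⬝ᵥ M⁻¹ *ᵥ v with hq
  have hs := pd_symm hM.inv
  have e : (M + t • vecMulVec v v)⁻¹ =
      M⁻¹ - (t / (1 + t * q)) • vecMulVec (M⁻¹ *ᵥ v) (M⁻¹ *ᵥ v) := by
    apply inv_eq_right_inv
    have h2 : M *ᵥ (M⁻¹ *ᵥ v) = v := by rw [mulVec_mulVec, pd_mul_inv hM, one_mulVec]
    have h4 : v ᵥ* M⁻¹ = M⁻¹ *ᵥ v := by rw [← mulVec_transpose, hs]
    rw [mul_sub, add_mul, add_mul, pd_mul_inv hM, mul_smul_comm, mul_smul_comm, mul_vecMulVec, h2,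
      smul_mul_assoc, smul_mul_assoc, vecMulVec_mul, h4, vecMulVec_mul_vecMulVec, ← hq]
    ext i j
    simp [vecMulVec_apply]
    field_simp
    ring
  rw [e, trace_sub, trace_smul, trace_vecMulVec, ← mulVec_mulVec, symm_dot hs v, smul_eq_mul]
  ring

/-- `|x|^2 ≤ Tr(M⁻¹) x^T M x`. -/
lemma trace_bound {M : Matrix (Fin k) (Fin k) ℝ} (hM : M.PosDef) (x : Fin k → ℝ) :
    x ⬝ᵥ x ≤ trace M⁻¹ * (x ⬝ᵥ M *ᵥ x) := by
  have h : ∀ j, x j * x j ≤ M⁻¹ j j * (x ⬝ᵥ M *ᵥ x) := by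
    intro j
    have := cs hM (Pi.single j 1) x
    simpa [pow_two] using this
  calc x ⬝ᵥ x = ∑ j, x j * x j := rfl
    _ ≤ ∑ j, M⁻¹ j j * (x ⬝ᵥ M *ᵥ x) := Finset.sum_le_sum fun j _ => h j
    _ = _ := by rw [← Finset.sum_mul]; rfl

lemma pd_shift {M : Matrix (Fin k) (Fin k) ℝ} (hM : M.PosDef) {δ : ℝ} (hδ : 0 < δ)
    (h : δ * trace M⁻¹ < 1) : (M - δ • 1).PosDef := by
  apply pd_of
  · simp [pd_symm hM]
  · intro x hx
    have h1 := pd_pos hM hx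
    have h2 := trace_bound hM x
    have : x ⬝ᵥ (M - δ • 1) *ᵥ x = x ⬝ᵥ M *ᵥ x - δ * (x ⬝ᵥ x) := by
      rw [sub_mulVec, smul_mulVec, one_mulVec, dotProduct_sub, dotProduct_smul, smul_eq_mul]
    rw [this]
    nlinarith [mul_le_mul_of_nonneg_left h2 hδ.le, mul_lt_mul_of_pos_right h h1]

lemma pd_add {M : Matrix (Fin k) (Fin k) ℝ} (hM : M.PosDef) {δ : ℝ} (hδ : 0 < δ) :
    (M + δ • 1).PosDef := hM.add (PosDef.one.smul hδ)

/-- trace of `X^T P X` is nonneg -/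
lemma trace_conj_nonneg {P : Matrix (Fin k) (Fin k) ℝ} (hP : P.PosDef)
    (X : Matrix (Fin k) (Fin k) ℝ) : 0 ≤ trace (Xᵀ * P * X) := by
  have := (hP.posSemidef.conjTranspose_mul_mul_same X).trace_nonneg
  rwa [conjTranspose_eq_transpose_of_trivial] at this

lemma sq_trace_pos [NeZero k] {P : Matrix (Fin k) (Fin k) ℝ} (hP : P.PosDef) :
    0 < trace (P * P) := by
  have h : 0 ≤ trace (P * P) := by
    have := trace_conj_nonneg (PosDef.one) P
    simpa [pd_symm hP] using this
  have h1 : 0 < trace P := hP.trace_pos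
  have h2 := trace_conj_nonneg hP (1 - P)
  have h3 := trace_conj_nonneg hP P
  rcases h.lt_or_eq with h' | h'
  · exact h'
  · exfalso
    have : Pᴴ * P = 0 := by
      have h0 : Pᴴ = P := hP.isHermitian
      rw [← trace_conjTranspose_mul_self_eq_zero_iff.trans (conjTranspose_mul_self_eq_zero).symm, h0]
      exact h'.symm
    rw [conjTranspose_mul_self_eq_zero] at this
    rw [this] at h1
    simp at h1

/-- resolvent identity: for `M' = M + δ`. -/
lemma resolvent {M M' : Matrix (Fin k) (Fin k) ℝ} (hM : M.PosDef) (hM' : M'.PosDef) {δ : ℝ}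
    (h : M' = M + δ • 1) : M⁻¹ - M'⁻¹ = δ • (M⁻¹ * M'⁻¹) := by
  have : M⁻¹ * (M' - M) * M'⁻¹ = M⁻¹ - M'⁻¹ := by
    rw [mul_sub, sub_mul, mul_assoc, pd_mul_inv hM', pd_inv_mul hM]; simp
  rw [← this, h]; simp

lemma resolvent_comm {M M' : Matrix (Fin k) (Fin k) ℝ} {δ : ℝ}
    (h : M' = M + δ • 1) : M⁻¹ * M'⁻¹ = M'⁻¹ * M⁻¹ := by
  have : M * M' = M' * M := by rw [h]; simp [mul_add, add_mul]
  rw [← Matrix.mul_inv_rev, ← Matrix.mul_inv_rev, this]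


lemma upper_gap {M M' : Matrix (Fin k) (Fin k) ℝ} (hM : M.PosDef) (hM' : M'.PosDef) {δ : ℝ}
    (hδ : 0 < δ) (h : M' = M + δ • 1) :
    δ * trace (M'⁻¹ * M'⁻¹) ≤ trace M⁻¹ - trace M'⁻¹ := by
  have e := resolvent hM hM' h
  have e2 : M⁻¹ * M'⁻¹ = M'⁻¹ * M'⁻¹ + δ • (M'⁻¹ᵀ * M⁻¹ * M'⁻¹) := by
    rw [pd_symm hM'.inv, ← resolvent_comm h, ← smul_mul_assoc, ← e, sub_mul]
    abel
  have e3 := trace_conj_nonneg hM.inv M'⁻¹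
  rw [← trace_sub, e, trace_smul, e2, trace_add, trace_smul, smul_eq_mul, smul_eq_mul]
  have := mul_nonneg hδ.le (mul_nonneg hδ.le e3)
  linarith

lemma upper_sum [NeZero k] {M M' : Matrix (Fin k) (Fin k) ℝ} (hM : M.PosDef) (hM' : M'.PosDef)
    {δ : ℝ} (hδ : 0 < δ) (h : M' = M + δ • 1) :
    trace (M'⁻¹ * M'⁻¹) / (trace M⁻¹ - trace M'⁻¹) + trace M'⁻¹ ≤ 1 / δ + trace M⁻¹ := by
  have h1 := upper_gap hM hM' hδ h
  have h2 := mul_pos hδ (sq_trace_pos hM'.inv)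
  have h3 : trace (M'⁻¹ * M'⁻¹) / (trace M⁻¹ - trace M'⁻¹) ≤ 1 / δ := by
    rw [div_le_div_iff₀ (by linarith) hδ]
    linarith
  linarith

lemma lower_sum [NeZero k] {N N' : Matrix (Fin k) (Fin k) ℝ} (hN : N.PosDef) (hN' : N'.PosDef)
    {δ : ℝ} (hδ : 0 < δ) (h : N = N' + δ • 1) (hT : δ * trace N⁻¹ ≤ 1) :
    1 / δ - trace N⁻¹ ≤ trace (N'⁻¹ * N'⁻¹) / (trace N'⁻¹ - trace N⁻¹) - trace N'⁻¹ := by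
  have h1 := upper_gap hN' hN hδ h
  have h2 := mul_pos hδ (sq_trace_pos hN.inv)
  have e := resolvent hN' hN h
  have ec := resolvent_comm h
  have hs := pd_symm hN'.inv
  set S := trace (N'⁻¹ * N⁻¹) with hS
  set R := trace (N'⁻¹ᵀ * N⁻¹ * N'⁻¹) with hR
  have hR0 : 0 ≤ R := trace_conj_nonneg hN.inv N'⁻¹
  have hD : trace N'⁻¹ - trace N⁻¹ = δ * S := by
    rw [← trace_sub, e, trace_smul, smul_eq_mul]
  have hSpos : 0 < S := by
    rw [hD] at h1
    exact pos_of_mul_pos_right (by linarith) hδ.le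
  have hQ : trace (N'⁻¹ * N'⁻¹) = S + δ * R := by
    have e5 : δ * R = trace (δ • (N'⁻¹ᵀ * N⁻¹ * N'⁻¹)) := by rw [trace_smul, smul_eq_mul]
    rw [hS, e5, hs, ← trace_add]
    congr 1
    rw [ ← smul_mul_assoc, ← e, sub_mul, ec]
    abel
  have hCS : S ^ 2 ≤ trace N⁻¹ * R := by
    have key : ∀ s : ℝ, 0 ≤ R * (s * s) + (2 * S) * s + trace N⁻¹ := by
      intro s
      have := trace_conj_nonneg hN.inv (1 + s • N'⁻¹)
      rw [transpose_add, transpose_smul, transpose_one] at this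
      simp only [add_mul, mul_add, trace_add, trace_smul, one_mul, mul_one, smul_mul_assoc, mul_smul_comm,
        smul_eq_mul] at this
      rw [← hR, hs, ← ec, ← hS] at this
      linarith
    have := discrim_le_zero key
    unfold discrim at this
    nlinarith
  rw [hQ, hD]
  have h5 : trace N'⁻¹ = trace N⁻¹ + δ * S := by linarith
  rw [h5]
  have h6 : (S + δ * R) / (δ * S) = 1 / δ + R / S := by field_simp
  have h7 : δ * S ≤ R / S := by
    rw [le_div_iff₀ hSpos]
    nlinarith [mul_le_mul_of_nonneg_left hCS hδ.le, mul_le_mul_of_nonneg_right hT hR0]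
  rw [h6]
  linarith

lemma q2_eq {P : Matrix (Fin k) (Fin k) ℝ} (hP : P.PosDef) (v : Fin k → ℝ) :
    v ⬝ᵥ (P * P) *ᵥ v = (P *ᵥ v) ⬝ᵥ (P *ᵥ v) := by
  rw [← mulVec_mulVec, symm_dot (pd_symm hP) v]

lemma q2_nonneg {P : Matrix (Fin k) (Fin k) ℝ} (hP : P.PosDef) (v : Fin k → ℝ) :
    0 ≤ v ⬝ᵥ (P * P) *ᵥ v := by
  rw [q2_eq hP]
  exact Finset.sum_nonneg fun i _ => mul_self_nonneg _

lemma upper_step {M M' : Matrix (Fin k) (Fin k) ℝ} (hM' : M'.PosDef)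
    (hD : 0 < trace M⁻¹ - trace M'⁻¹) (v : Fin k → ℝ) (t : ℝ) (ht : 0 < t)
    (h2 : 0 < v ⬝ᵥ (M'⁻¹ * M'⁻¹) *ᵥ v)
    (h : t * ((v ⬝ᵥ (M'⁻¹ * M'⁻¹) *ᵥ v) / (trace M⁻¹ - trace M'⁻¹) + v ⬝ᵥ M'⁻¹ *ᵥ v) ≤ 1) :
    (M' - t • vecMulVec v v).PosDef ∧ trace (M' - t • vecMulVec v v)⁻¹ ≤ trace M⁻¹ := by
  set q2 := v ⬝ᵥ (M'⁻¹ * M'⁻¹) *ᵥ v with hq2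
  set q1 := v ⬝ᵥ M'⁻¹ *ᵥ v with hq1
  set D := trace M⁻¹ - trace M'⁻¹ with hDd
  have hp : 0 < t * (q2 / D) := by positivity
  have hden : 0 < 1 + (-t) * q1 := by nlinarith
  have e : M' - t • vecMulVec v v = M' + (-t) • vecMulVec v v := by
    rw [neg_smul, sub_eq_add_neg]
  rw [e]
  refine ⟨pd_update hM' v (-t) hden, ?_⟩
  rw [trace_update hM' v (-t) hden, ← hq2, ← hq1]
  have : t * q2 / (1 + -t * q1) ≤ D := by
    rw [div_le_iff₀ hden]
    have h3 : t * q2 = D * (t * (q2 / D)) := by field_simp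
    rw [h3]
    apply mul_le_mul_of_nonneg_left _ hD.le
    linarith
  have h4 : -t * q2 / (1 + -t * q1) = -(t * q2 / (1 + -t * q1)) := by ring
  rw [h4]
  linarith

lemma lower_step {N N' : Matrix (Fin k) (Fin k) ℝ} (hN' : N'.PosDef)
    (hD : 0 < trace N'⁻¹ - trace N⁻¹) (v : Fin k → ℝ) (t : ℝ) (ht : 0 < t)
    (h : 1 ≤ t * ((v ⬝ᵥ (N'⁻¹ * N'⁻¹) *ᵥ v) / (trace N'⁻¹ - trace N⁻¹) - v ⬝ᵥ N'⁻¹ *ᵥ v)) :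
    (N' + t • vecMulVec v v).PosDef ∧ trace (N' + t • vecMulVec v v)⁻¹ ≤ trace N⁻¹ := by
  have hq1' := psd_nonneg hN'.inv.posSemidef v
  set q2 := v ⬝ᵥ (N'⁻¹ * N'⁻¹) *ᵥ v with hq2
  set q1 := v ⬝ᵥ N'⁻¹ *ᵥ v with hq1
  set D := trace N'⁻¹ - trace N⁻¹ with hDd
  have hden : 0 < 1 + t * q1 := by positivity
  refine ⟨pd_update hN' v t hden, ?_⟩
  rw [trace_update hN' v t hden, ← hq2, ← hq1]
  have : D ≤ t * q2 / (1 + t * q1) := by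
    rw [le_div_iff₀ hden]
    have h3 : t * q2 = D * (t * (q2 / D)) := by field_simp
    rw [h3]
    apply mul_le_mul_of_nonneg_left _ hD.le
    linarith
  linarith

variable {ι : Type*} [Fintype ι]

lemma sum_quad (v : ι → Fin k → ℝ) (hv : ∑ i, vecMulVec (v i) (v i) = 1)
    (P : Matrix (Fin k) (Fin k) ℝ) : ∑ i, v i ⬝ᵥ P *ᵥ v i = trace P := by
  have : ∀ i, v i ⬝ᵥ P *ᵥ v i = trace (P * vecMulVec (v i) (v i)) := by
    intro i
    rw [mul_vecMulVec, trace_vecMulVec, dotProduct_comm]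
  simp_rw [this]
  rw [← trace_sum, ← Finset.mul_sum, hv, mul_one]

/-- The barrier invariant. -/
def Inv (A : Matrix (Fin k) (Fin k) ℝ) (u l a b : ℝ) : Prop :=
  (u • 1 - A).PosDef ∧ (A - l • 1).PosDef ∧ trace (u • 1 - A)⁻¹ ≤ a ∧ trace (A - l • 1)⁻¹ ≤ b

lemma step [NeZero k] (v : ι → Fin k → ℝ) (hv : ∑ i, vecMulVec (v i) (v i) = 1)
    {A : Matrix (Fin k) (Fin k) ℝ} {u l a b dU dL : ℝ} (hA : Inv A u l a b)
    (hU : 0 < dU) (hL : 0 < dL) (hb : dL * b < 1) (hab : 1 / dU + a ≤ 1 / dL - b) :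
    ∃ i, ∃ t : ℝ, 0 < t ∧ Inv (A + t • vecMulVec (v i) (v i)) (u + dU) (l + dL) a b := by
  obtain ⟨hM, hN, hMa, hNb⟩ := hA
  set M := u • 1 - A with hMd
  set N := A - l • 1 with hNd
  have eM : (u + dU) • 1 - A = M + dU • 1 := by rw [hMd, add_smul]; abel
  have eN : A - (l + dL) • 1 = N - dL • 1 := by rw [hNd, add_smul]; abel
  have hM' : (M + dU • 1).PosDef := pd_add hM hU
  have hbN : dL * trace N⁻¹ < 1 := lt_of_le_of_lt (mul_le_mul_of_nonneg_left hNb hL.le) hb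
  have hN' : (N - dL • 1).PosDef := pd_shift hN hL hbN
  set M' := M + dU • 1 with hM'd
  set N' := N - dL • 1 with hN'd
  have eN' : N = N' + dL • 1 := by rw [hN'd]; abel
  have sU := upper_sum hM hM' hU hM'd
  have sL := lower_sum hN hN' hL eN' hbN.le
  have gU := lt_of_lt_of_le (mul_pos hU (sq_trace_pos hM'.inv)) (upper_gap hM hM' hU hM'd)
  have gL := lt_of_lt_of_le (mul_pos hL (sq_trace_pos hN.inv)) (upper_gap hN' hN hL eN')
  set DU := trace M⁻¹ - trace M'⁻¹ with hDU
  set DL := trace N'⁻¹ - trace N⁻¹ with hDL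
  let fU : ι → ℝ := fun i => (v i ⬝ᵥ (M'⁻¹ * M'⁻¹) *ᵥ v i) / DU + v i ⬝ᵥ M'⁻¹ *ᵥ v i
  let fL : ι → ℝ := fun i => (v i ⬝ᵥ (N'⁻¹ * N'⁻¹) *ᵥ v i) / DL - v i ⬝ᵥ N'⁻¹ *ᵥ v i
  have hsU : ∑ i, fU i = trace (M'⁻¹ * M'⁻¹) / DU + trace M'⁻¹ := by
    simp only [fU]
    rw [Finset.sum_add_distrib, ← Finset.sum_div, sum_quad v hv, sum_quad v hv]
  have hsL : ∑ i, fL i = trace (N'⁻¹ * N'⁻¹) / DL - trace N'⁻¹ := by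
    simp only [fL]
    rw [Finset.sum_sub_distrib, ← Finset.sum_div, sum_quad v hv, sum_quad v hv]
  have hle : ∑ i, fU i ≤ ∑ i, fL i := by rw [hsU, hsL]; linarith
  have hpos : ∀ i, v i ≠ 0 → 0 < v i ⬝ᵥ (M'⁻¹ * M'⁻¹) *ᵥ v i ∧ 0 < fU i := by
    intro i hi
    have h1 := pd_pos hM'.inv hi
    have h2 : 0 < v i ⬝ᵥ (M'⁻¹ * M'⁻¹) *ᵥ v i := by
      refine lt_of_le_of_ne (q2_nonneg hM'.inv _) fun h0 => ?_
      rw [q2_eq hM'.inv] at h0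
      have := dotProduct_self_eq_zero.1 h0.symm
      rw [this] at h1
      simp at h1
    exact ⟨h2, add_pos (div_pos h2 gU) h1⟩
  obtain ⟨i, hi, hfi⟩ : ∃ i, v i ≠ 0 ∧ fU i ≤ fL i := by
    by_contra hcon
    push Not at hcon
    have hle' : ∀ i ∈ Finset.univ, fL i ≤ fU i := by
      intro i _
      by_cases h0 : v i = 0
      · simp [fL, fU, h0]
      · exact (hcon i h0).le
    obtain ⟨i, hi⟩ : ∃ i, v i ≠ 0 := by
      by_contra hz
      push Not at hz
      simp [hz] at hv
    have := Finset.sum_lt_sum hle' ⟨i, Finset.mem_univ i, hcon i hi⟩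
    linarith
  obtain ⟨p2, pU⟩ := hpos i hi
  refine ⟨i, 1 / fU i, by positivity, ?_⟩
  have ht : 0 < 1 / fU i := by positivity
  have hu := upper_step (M := M) hM' gU (v i) (1 / fU i) ht p2 (by
    change 1 / fU i * fU i ≤ 1
    rw [one_div_mul_cancel pU.ne'])
  have hl := lower_step (N := N) hN' gL (v i) (1 / fU i) ht (by
    change 1 ≤ 1 / fU i * fL i
    rw [div_mul_eq_mul_div, one_mul, le_div_iff₀ pU]
    linarith)
  have e1 : (u + dU) • 1 - (A + (1 / fU i) • vecMulVec (v i) (v i))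
      = M' - (1 / fU i) • vecMulVec (v i) (v i) := by rw [← eM]; abel
  have e2 : (A + (1 / fU i) • vecMulVec (v i) (v i)) - (l + dL) • 1
      = N' + (1 / fU i) • vecMulVec (v i) (v i) := by rw [← eN]; abel
  unfold Inv
  rw [e1, e2]
  exact ⟨hu.1, hl.1, hu.2.trans hMa, hl.2.trans hNb⟩

lemma iterate [NeZero k] [DecidableEq ι] (v : ι → Fin k → ℝ)
    (hv : ∑ i, vecMulVec (v i) (v i) = 1)
    {u l a b dU dL : ℝ} (h0 : Inv (0 : Matrix (Fin k) (Fin k) ℝ) u l a b)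
    (hU : 0 < dU) (hL : 0 < dL) (hb : dL * b < 1) (hab : 1 / dU + a ≤ 1 / dL - b) (T : ℕ) :
    ∃ s : ι → ℝ, (∀ i, 0 ≤ s i) ∧ (Finset.univ.filter fun i => s i ≠ 0).card ≤ T ∧
      Inv (∑ i, s i • vecMulVec (v i) (v i)) (u + T * dU) (l + T * dL) a b := by
  induction T with
  | zero => exact ⟨fun _ => 0, by simp, by simp, by simpa using h0⟩
  | succ T ih =>
    obtain ⟨s, hs, hc, hI⟩ := ih
    obtain ⟨i, t, ht, hI'⟩ := step v hv hI hU hL hb hab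
    refine ⟨fun j => s j + if j = i then t else 0, ?_, ?_, ?_⟩
    · intro j
      have := hs j
      dsimp only
      split_ifs <;> linarith
    · refine (Finset.card_le_card (t := insert i (Finset.univ.filter fun i => s i ≠ 0)) ?_).trans
        ((Finset.card_insert_le _ _).trans (by omega))
      intro j hj
      by_cases hji : j = i
      · simp [hji]
      · simpa [hji] using hj
    · have e : ∑ j, (s j + if j = i then t else 0) • vecMulVec (v j) (v j)
          = ∑ j, s j • vecMulVec (v j) (v j) + t • vecMulVec (v i) (v i) := by
        simp [add_smul, Finset.sum_add_distrib, ite_smul]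
      rw [e]
      convert hI' using 1 <;> push_cast <;> ring

lemma quad_sum (v : ι → Fin k → ℝ) (s : ι → ℝ) (y : Fin k → ℝ) :
    y ⬝ᵥ (∑ i, s i • vecMulVec (v i) (v i)) *ᵥ y = ∑ i, s i * (v i ⬝ᵥ y) ^ 2 := by
  rw [sum_mulVec, dotProduct_sum]
  refine Finset.sum_congr rfl fun i _ => ?_
  rw [smul_mulVec, vecMulVec_mulVec, dotProduct_smul, smul_eq_mul]
  simp [dotProduct_comm y (v i)]
  left
  ring

lemma bss [NeZero k] [DecidableEq ι] (v : ι → Fin k → ℝ)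
    (hv : ∑ i, vecMulVec (v i) (v i) = 1) (r : ℕ) (hr : 2 ≤ r) :
    ∃ s : ι → ℝ, (∀ i, 0 ≤ s i) ∧ (Finset.univ.filter fun i => s i ≠ 0).card ≤ r ^ 2 * k ∧
      ∀ y : Fin k → ℝ, ((r : ℝ) - 1) / (r + 1) * (y ⬝ᵥ y) ≤ ∑ i, s i * (v i ⬝ᵥ y) ^ 2 ∧
        ∑ i, s i * (v i ⬝ᵥ y) ^ 2 ≤ ((r : ℝ) + 1) / (r - 1) * (y ⬝ᵥ y) := by
  have hr' : (2 : ℝ) ≤ r := by exact_mod_cast hr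
  have hk : (0 : ℝ) < k := by exact_mod_cast Nat.pos_of_ne_zero (NeZero.ne k)
  have hr1 : (0 : ℝ) < r - 1 := by linarith
  have hr0 : (0 : ℝ) < r := by linarith
  set R : ℝ := (r : ℝ) with hR
  have hu0 : 0 < k * (R * (R + 1)) / (R - 1) := by positivity
  have hl0 : 0 < k * R := by positivity
  have inv_smul' : ∀ c : ℝ, 0 < c → trace (c • (1 : Matrix (Fin k) (Fin k) ℝ))⁻¹ = k / c := by
    intro c hc
    have : (c • (1 : Matrix (Fin k) (Fin k) ℝ))⁻¹ = c⁻¹ • 1 := by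
      apply inv_eq_right_inv
      simp [smul_smul, hc.ne']
    rw [this]
    simp [trace_smul]
    field_simp
  have h0 : Inv (0 : Matrix (Fin k) (Fin k) ℝ) (k * (R * (R + 1)) / (R - 1)) (-(k * R))
      ((R - 1) / (R * (R + 1))) (1 / R) := by
    unfold Inv
    rw [sub_zero, zero_sub, neg_smul, neg_neg, inv_smul' _ hu0, inv_smul' _ hl0]
    refine ⟨PosDef.one.smul hu0, PosDef.one.smul hl0, le_of_eq ?_, le_of_eq ?_⟩
    · field_simp
    · field_simp
  obtain ⟨s, hs, hc, hI⟩ := iterate v hv h0 (dU := (R + 1) / (R - 1)) (dL := 1) (by positivity)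
    one_pos (by rw [one_mul, div_lt_one hr0]; linarith)
    (le_of_eq (by field_simp)) (r ^ 2 * k)
  have hsc : 0 < k * (R * (R + 1)) := by positivity
  refine ⟨fun i => s i / (k * (R * (R + 1))), fun i => div_nonneg (hs i) hsc.le, ?_, ?_⟩
  · refine le_trans (le_of_eq ?_) hc
    congr 1
    ext i
    simp [hsc.ne']
  · intro y
    have e : ∑ i, s i / (k * (R * (R + 1))) * (v i ⬝ᵥ y) ^ 2
        = (∑ i, s i * (v i ⬝ᵥ y) ^ 2) / (k * (R * (R + 1))) := by
      rw [Finset.sum_div]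
      exact Finset.sum_congr rfl fun i _ => by ring
    rw [e, ← quad_sum]
    have h1 := psd_nonneg hI.1.posSemidef y
    have h2 := psd_nonneg hI.2.1.posSemidef y
    rw [sub_mulVec, smul_mulVec, one_mulVec, dotProduct_sub, dotProduct_smul, smul_eq_mul] at h1 h2
    push_cast at h1 h2
    rw [le_div_iff₀ hsc, div_le_iff₀ hsc]
    have a1 : (R + 1) / (R - 1) * (y ⬝ᵥ y) * (k * (R * (R + 1)))
      = (k * (R * (R + 1)) / (R - 1) + R ^ 2 * k * ((R + 1) / (R - 1))) * (y ⬝ᵥ y) := by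
      field_simp
      ring
    have a2 : (R - 1) / (R + 1) * (y ⬝ᵥ y) * (k * (R * (R + 1)))
      = (-(k * R) + R ^ 2 * k * 1) * (y ⬝ᵥ y) := by
      field_simp
      ring
    rw [a1, a2]
    constructor <;> linarith

lemma sparsify [DecidableEq ι] (n : ℕ) (B : (Fin n → ℝ) →ₗ[ℝ] EuclideanSpace ℝ ι)
    (r : ℕ) (hr : 2 ≤ r) :
    ∃ s : ι → ℝ, (∀ i, 0 ≤ s i) ∧ (Finset.univ.filter fun i => s i ≠ 0).card ≤ r ^ 2 * n ∧
      ∀ x, ((r : ℝ) - 1) / (r + 1) * ∑ i, (B x i) ^ 2 ≤ ∑ i, s i * (B x i) ^ 2 ∧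
        ∑ i, s i * (B x i) ^ 2 ≤ ((r : ℝ) + 1) / (r - 1) * ∑ i, (B x i) ^ 2 := by
  set W := LinearMap.range B with hW
  set k := Module.finrank ℝ W with hk
  have hkn : k ≤ n := by
    have := LinearMap.finrank_range_le B
    simpa using this
  let o : OrthonormalBasis (Fin k) ℝ W := stdOrthonormalBasis ℝ W
  let v : ι → Fin k → ℝ := fun i j => ((o j : W) : EuclideanSpace ℝ ι) i
  have hv : ∑ i, vecMulVec (v i) (v i) = 1 := by
    ext j j'
    have h := (orthonormal_iff_ite.1 o.orthonormal) j j'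
    rw [Submodule.coe_inner, PiLp.inner_apply] at h
    rw [Matrix.sum_apply, one_apply, ← h]
    refine Finset.sum_congr rfl fun i _ => ?_
    simp [vecMulVec_apply, v, mul_comm]
  let y : (Fin n → ℝ) → Fin k → ℝ := fun x => o.repr ⟨B x, LinearMap.mem_range_self B x⟩
  have hy : ∀ x i, v i ⬝ᵥ y x = B x i := by
    intro x i
    have h := o.sum_repr ⟨B x, LinearMap.mem_range_self B x⟩
    have h2 := congrArg (fun z : W => (z : EuclideanSpace ℝ ι) i) h
    simp only at h2
    rw [← h2]
    simp [dotProduct, v, y, mul_comm]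
  have hyy : ∀ x, y x ⬝ᵥ y x = ∑ i, (B x i) ^ 2 := by
    intro x
    have h := quad_sum v (fun _ => 1) (y x)
    simp only [one_smul, hv, one_mulVec, one_mul, hy] at h
    exact h
  by_cases hk0 : k = 0
  · refine ⟨fun _ => 0, by simp, by simp, ?_⟩
    intro x
    have : ∑ i, (B x i) ^ 2 = 0 := by
      rw [← hyy x]
      have : IsEmpty (Fin k) := by rw [hk0]; infer_instance
      simp [dotProduct]
    rw [this]
    simp
  · have : NeZero k := ⟨hk0⟩
    obtain ⟨s, hs, hc, hq⟩ := bss v hv r hr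
    refine ⟨s, hs, hc.trans (Nat.mul_le_mul_left _ hkn), fun x => ?_⟩
    have := hq (y x)
    simp only [hy, hyy] at this
    exact this

end BSS

lemma BSS.lapQ_eq {n : ℕ} (w : Fin n → Fin n → ℝ) (hw : ∀ u v, w u v = w v u) (x : Fin n → ℝ) :
    lapQ w x = ∑ e : Fin n × Fin n,
      if e.1 < e.2 then w e.1 e.2 * (x e.1 - x e.2) ^ 2 else 0 := by
  unfold lapQ
  rw [Fintype.sum_prod_type]
  have h : ∀ u v : Fin n, w u v * (x u - x v) ^ 2 =
      (if u < v then w u v * (x u - x v) ^ 2 else 0) +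
        (if v < u then w v u * (x v - x u) ^ 2 else 0) := by
    intro u v
    rcases lt_trichotomy u v with h | h | h
    · simp [h, h.not_gt]
    · simp [h]
    · simp only [h, h.not_gt, if_true, if_false, hw u v]
      ring
  rw [Finset.sum_congr rfl fun u _ => Finset.sum_congr rfl fun v _ => h u v]
  simp_rw [Finset.sum_add_distrib]
  rw [Finset.sum_comm (f := fun u v => if v < u then w v u * (x v - x u) ^ 2 else 0)]
  ring

/--
**existence of spectral sparsifiers of graphs with bounded
integer weights: guarantee of `BoundedSparsify`.**
There is an absolute constant `c` such that for every `ε ∈ (0,1/2)`,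
`p ∈ (0,1/2)`, integer `U ≥ 2`, and weighted graph `G` on `n` vertices whose
edge weights are integers in `{1,…,U−1}`, there exists a weighted graph `G̃`
whose edges form a subset of the edges of `G`, such that `G̃` is a
`(1+ε)`-spectral approximation of `G` and `G̃` has at most
`c · ε⁻² · n · log₂ U · log₂³¹(n/p)` edges.
-/
theorem stmt16 :
    ∃ c : ℝ, 0 < c ∧
      ∀ (n U : ℕ) (ε p : ℝ), 0 < ε → ε < 1 / 2 → 0 < p → p < 1 / 2 → 2 ≤ U →
      ∀ w : Fin n → Fin n → ℝ,
        (∀ u v, w u v = w v u) → (∀ v, w v v = 0) →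
        (∀ u v, w u v = 0 ∨ ∃ m : ℕ, 1 ≤ m ∧ m ≤ U - 1 ∧ w u v = (m : ℝ)) →
        ∃ wt : Fin n → Fin n → ℝ,
          (∀ u v, wt u v = wt v u) ∧ (∀ u v, 0 ≤ wt u v) ∧
          (∀ u v, wt u v ≠ 0 → w u v ≠ 0) ∧
          (∀ x : Fin n → ℝ,
            (1 / (1 + ε)) * lapQ wt x ≤ lapQ w x ∧
              lapQ w x ≤ (1 + ε) * lapQ wt x) ∧
          ((Finset.univ.filter fun e : Fin n × Fin n =>
              e.1 < e.2 ∧ wt e.1 e.2 ≠ 0).card : ℝ) ≤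
            c * ε⁻¹ ^ 2 * (n : ℝ) * Real.logb 2 (U : ℝ) *
              Real.logb 2 ((n : ℝ) / p) ^ 31 := by
  refine ⟨9, by norm_num, ?_⟩
  intro n U ε p hε hε2 hp hp2 hU w hsym hdiag hw
  have hw0 : ∀ u v, 0 ≤ w u v := by
    intro u v
    rcases hw u v with h | ⟨m, _, _, h⟩
    · exact h.ge
    · rw [h]; positivity
  set r := ⌈1 + 2 / ε⌉₊ with hr
  have hr1 : 1 + 2 / ε ≤ (r : ℝ) := Nat.le_ceil _
  have hr2 : (r : ℝ) < 1 + 2 / ε + 1 := Nat.ceil_lt_add_one (by positivity)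
  have hie : 2 < 1 / ε := by rw [lt_div_iff₀ hε]; linarith
  have h2e : 2 / ε = 2 * (1 / ε) := by ring
  have hrR : (2 : ℝ) ≤ r := by linarith
  have hrN : 2 ≤ r := by exact_mod_cast hrR
  have hr3 : (r : ℝ) ≤ 3 * ε⁻¹ := by rw [← one_div]; linarith
  have hre : 2 ≤ ε * ((r : ℝ) - 1) := by
    have : 2 / ε ≤ (r : ℝ) - 1 := by linarith
    rw [div_le_iff₀ hε] at this
    linarith
  let B : (Fin n → ℝ) →ₗ[ℝ] EuclideanSpace ℝ (Fin n × Fin n) :=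
    { toFun := fun x => WithLp.toLp 2 fun e =>
        if e.1 < e.2 then Real.sqrt (w e.1 e.2) * (x e.1 - x e.2) else 0
      map_add' := by
        intro x y
        ext e
        simp only [PiLp.add_apply, Pi.add_apply]
        split_ifs <;> ring
      map_smul' := by
        intro c x
        ext e
        simp only [PiLp.smul_apply, Pi.smul_apply, smul_eq_mul, RingHom.id_apply]
        split_ifs <;> ring }
  have hB : ∀ x e, (B x e) ^ 2 = if e.1 < e.2 then w e.1 e.2 * (x e.1 - x e.2) ^ 2 else 0 := by
    intro x e
    change (if e.1 < e.2 then Real.sqrt (w e.1 e.2) * (x e.1 - x e.2) else 0) ^ 2 = _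
    split_ifs
    · rw [mul_pow, Real.sq_sqrt (hw0 _ _)]
    · simp
  obtain ⟨s, hs, hc, hq⟩ := BSS.sparsify n B r hrN
  have hwts : ∀ u v, s (min u v, max u v) * w u v = s (min v u, max v u) * w v u := by
    intro u v
    rw [min_comm, max_comm, hsym]
  refine ⟨fun u v => s (min u v, max u v) * w u v, hwts,
    fun u v => mul_nonneg (hs _) (hw0 _ _), fun u v h => right_ne_zero_of_mul h, ?_, ?_⟩
  · intro x
    have e1 : ∑ e, (B x e) ^ 2 = lapQ w x := by
      rw [BSS.lapQ_eq w hsym]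
      exact Finset.sum_congr rfl fun e _ => hB x e
    have e2 : ∑ e, s e * (B x e) ^ 2 = lapQ (fun u v => s (min u v, max u v) * w u v) x := by
      rw [BSS.lapQ_eq _ hwts]
      refine Finset.sum_congr rfl fun e _ => ?_
      rw [hB]
      split_ifs with h
      · rw [min_eq_left h.le, max_eq_right h.le]
        ring
      · simp
    have h0 : 0 ≤ lapQ w x := by
      rw [← e1]
      positivity
    obtain ⟨hl, hu⟩ := hq x
    rw [e1, e2] at hl hu
    set Lt := lapQ (fun u v => s (min u v, max u v) * w u v) x
    have a1 : ((r : ℝ) + 1) / (r - 1) ≤ 1 + ε := by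
      rw [div_le_iff₀ (by linarith)]
      linarith
    have a2 : 1 / (1 + ε) ≤ ((r : ℝ) - 1) / (r + 1) := by
      rw [div_le_div_iff₀ (by linarith) (by linarith)]
      linarith
    constructor
    · rw [one_div_mul_eq_div, div_le_iff₀ (by linarith)]
      calc Lt ≤ _ := hu
        _ ≤ (1 + ε) * lapQ w x := mul_le_mul_of_nonneg_right a1 h0
        _ = _ := by ring
    · have := (mul_le_mul_of_nonneg_right a2 h0).trans hl
      rw [one_div_mul_eq_div, div_le_iff₀ (by linarith)] at this
      linarith
  · have hcard : ((Finset.univ.filter fun e : Fin n × Fin n =>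
        e.1 < e.2 ∧ s (min e.1 e.2, max e.1 e.2) * w e.1 e.2 ≠ 0).card : ℝ)
          ≤ (r : ℝ) ^ 2 * n := by
      have : (Finset.univ.filter fun e : Fin n × Fin n =>
        e.1 < e.2 ∧ s (min e.1 e.2, max e.1 e.2) * w e.1 e.2 ≠ 0).card ≤ r ^ 2 * n := by
        refine (Finset.card_le_card ?_).trans hc
        intro e he
        simp only [Finset.mem_filter, Finset.mem_univ, true_and] at he ⊢
        have h1 := left_ne_zero_of_mul he.2
        rwa [min_eq_left he.1.le, max_eq_right he.1.le] at h1
      exact_mod_cast this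
    refine hcard.trans ?_
    rcases Nat.eq_zero_or_pos n with h0 | hn
    · simp [h0]
    have hn1 : (1 : ℝ) ≤ n := by exact_mod_cast hn
    have hU2 : (2 : ℝ) ≤ U := by exact_mod_cast hU
    have l1 : 1 ≤ Real.logb 2 (U : ℝ) := by
      rw [Real.le_logb_iff_rpow_le (by norm_num) (by linarith)]
      simpa using hU2
    have l2 : 1 ≤ Real.logb 2 ((n : ℝ) / p) := by
      rw [Real.le_logb_iff_rpow_le (by norm_num) (by positivity), Real.rpow_one,
        le_div_iff₀ hp]
      linarith
    have l3 : 1 ≤ Real.logb 2 ((n : ℝ) / p) ^ 31 := one_le_pow₀ l2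
    have l4 : (r : ℝ) ^ 2 ≤ 9 * ε⁻¹ ^ 2 := by
      calc (r : ℝ) ^ 2 ≤ (3 * ε⁻¹) ^ 2 := by gcongr
        _ = _ := by ring
    have hX : 0 ≤ 9 * ε⁻¹ ^ 2 * (n : ℝ) := by positivity
    calc (r : ℝ) ^ 2 * n ≤ 9 * ε⁻¹ ^ 2 * n := by gcongr
      _ ≤ 9 * ε⁻¹ ^ 2 * (n : ℝ) * Real.logb 2 (U : ℝ) := le_mul_of_one_le_right hX l1
      _ ≤ _ := le_mul_of_one_le_right (mul_nonneg hX (by linarith)) l3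
end

section
/- There is an absolute constant c such that for every n, every ε ∈ (1/n, 1/3), every p ∈ (0,1/2), and every weighted graph G = (V,E,w) with n vertices in which every edge has weight at most 1, there exists a weighted graph G̃ = (V, Ẽ, w̃) with Ẽ ⊆ E such that: G̃ is a (1+ε)-spectral approximation of G; G̃ has at most c·ε^{-2}·n·log^{34}(n/p) edges; and every vertex has blow-up at most 2, i.e., for every vertex v, (1/d_v)·Σ_{(u,v)∈E} blow(u,v) ≤ 2, where d_v is the degree of v in G and blow(u,v) = w̃_{(u,v)}/w_{(u,v)} if (u,v) ∈ Ẽ and 0 otherwise. -/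
section Bss
open Matrix

lemma bss_diag_exists {ι : Type*} [Fintype ι] [DecidableEq ι] (A : Matrix ι ι ℝ)
    (hA : A.IsHermitian) : ∃ (Q : Matrix ι ι ℝ) (lam : ι → ℝ),
      Qᵀ * Q = 1 ∧ Q * Qᵀ = 1 ∧ A = Q * diagonal lam * Qᵀ := by
  refine ⟨hA.eigenvectorUnitary, hA.eigenvalues, ?_, ?_, ?_⟩
  · have := Unitary.coe_star_mul_self hA.eigenvectorUnitary
    simpa [Matrix.star_eq_conjTranspose] using this
  · have := Unitary.coe_mul_star_self hA.eigenvectorUnitary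
    simpa [Matrix.star_eq_conjTranspose] using this
  · have := hA.spectral_theorem
    rw [Unitary.conjStarAlgAut_apply] at this
    simpa [Matrix.star_eq_conjTranspose, Function.comp_def] using this

lemma bss_rank1 {ι : Type*} [Fintype ι] [DecidableEq ι] (d a : ι → ℝ) (s : ℝ)
    (hd : ∀ i, 0 < d i) (hs : 0 < 1 + s * ∑ i, a i ^ 2 / d i) :
    (diagonal d + s • vecMulVec a a).PosDef ∧
    trace (diagonal d + s • vecMulVec a a)⁻¹ =
      ∑ i, 1 / d i - s * (∑ i, a i ^ 2 / d i ^ 2) / (1 + s * ∑ i, a i ^ 2 / d i) := by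
  set r := ∑ i, a i ^ 2 / d i with hr
  constructor
  · refine PosDef.of_dotProduct_mulVec_pos ?_ ?_
    · ext i j
      by_cases h : i = j
      · subst h; simp [vecMulVec_apply]
      · simp [vecMulVec_apply, h, Ne.symm h, mul_comm]
    · intro x hx
      have h1 : star x ⬝ᵥ ((diagonal d + s • vecMulVec a a) *ᵥ x)
          = ∑ i, d i * x i ^ 2 + s * (∑ i, a i * x i) ^ 2 := by
        rw [add_mulVec, dotProduct_add, smul_mulVec, dotProduct_smul, vecMulVec_mulVec]
        simp only [dotProduct, mulVec_diagonal, Pi.star_apply, star_trivial, smul_eq_mul]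
        congr 1
        · exact Finset.sum_congr rfl fun i _ => by ring
        · rw [sq]
          simp only [Pi.smul_apply, MulOpposite.smul_eq_mul_unop, MulOpposite.unop_op]
          congr 1
          rw [Finset.sum_mul]
          exact Finset.sum_congr rfl fun i _ => by ring
      rw [h1]
      have hcs : (∑ i, a i * x i) ^ 2 ≤ r * ∑ i, d i * x i ^ 2 := by
        refine Finset.sum_sq_le_sum_mul_sum_of_sq_le_mul _ ?_ ?_ ?_
        · intro i _; have := hd i; positivity
        · intro i _; have := hd i; positivity
        · intro i _
          have := (hd i).ne'
          apply le_of_eq; field_simp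
      have hpos : 0 < ∑ i, d i * x i ^ 2 := by
        obtain ⟨i, hi⟩ := Function.ne_iff.mp hx
        refine Finset.sum_pos' (fun j _ => by have := hd j; positivity) ⟨i, Finset.mem_univ _, ?_⟩
        have := hd i
        have : x i ≠ 0 := hi
        positivity
      rcases le_or_gt 0 s with h | h
      · have := sq_nonneg (∑ i, a i * x i); nlinarith [mul_nonneg h this]
      · nlinarith
  · have hinv : (diagonal d + s • vecMulVec a a)⁻¹ =
        diagonal (fun i => 1 / d i) - (s / (1 + s * r)) •
          vecMulVec (fun i => a i / d i) (fun i => a i / d i) := by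
      apply inv_eq_right_inv
      have h1 : diagonal d * diagonal (fun i => 1 / d i) = (1 : Matrix ι ι ℝ) := by
        rw [diagonal_mul_diagonal, ← diagonal_one]
        congr 1; ext i; have := (hd i).ne'; field_simp
      have h2 : diagonal d * vecMulVec (fun i => a i / d i) (fun i => a i / d i)
          = vecMulVec a (fun i => a i / d i) := by
        ext i j; rw [diagonal_mul]; simp only [vecMulVec_apply]
        have := (hd i).ne'; field_simp
      have h3 : vecMulVec a a * diagonal (fun i => 1 / d i) = vecMulVec a (fun i => a i / d i) := by
        ext i j; rw [mul_diagonal]; simp only [vecMulVec_apply]; ring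
      have h4 : vecMulVec a a * vecMulVec (fun i => a i / d i) (fun i => a i / d i)
          = r • vecMulVec a (fun i => a i / d i) := by
        rw [vecMulVec_mul_vecMulVec]
        have : a ⬝ᵥ (fun i => a i / d i) = r := by
          simp only [dotProduct, hr]; exact Finset.sum_congr rfl fun i _ => by ring
        rw [this]
        ext i j; simp [vecMulVec_apply]; ring
      rw [add_mul, mul_sub, mul_sub, Matrix.mul_smul, Matrix.smul_mul, Matrix.smul_mul,
        Matrix.mul_smul, h1, h2, h3, h4]
      ext i j
      simp only [Matrix.add_apply, Matrix.sub_apply, Matrix.smul_apply, smul_eq_mul]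
      have := hs.ne'
      field_simp
      ring
    rw [hinv, trace_sub, trace_smul, trace_diagonal, trace_vecMulVec]
    have : (fun i => a i / d i) ⬝ᵥ (fun i => a i / d i) = ∑ i, a i ^ 2 / d i ^ 2 := by
      simp only [dotProduct]; exact Finset.sum_congr rfl fun i _ => by ring
    rw [this, smul_eq_mul]; ring

lemma bss_upper_s18 {J E : Type*} [Fintype J] [Fintype E] (p : J → ℝ) (c : E → J → ℝ) (δ : ℝ)
    (hδ : 0 < δ) (hp : ∀ j, 0 < p j) (hc : ∀ j, ∑ e, c e j ≤ 1)
    (hD : 0 < ∑ j, (1 / p j - 1 / (p j + δ))) :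
    ∑ e, ((∑ j, c e j / (p j + δ) ^ 2) / (∑ j, (1 / p j - 1 / (p j + δ)))
      + ∑ j, c e j / (p j + δ)) ≤ 1 / δ + ∑ j, 1 / p j := by
  set D := ∑ j, (1 / p j - 1 / (p j + δ)) with hDdef
  rw [Finset.sum_add_distrib, ← Finset.sum_div, Finset.sum_comm,
    Finset.sum_comm (f := fun e j => c e j / (p j + δ))]
  simp_rw [← Finset.sum_div]
  gcongr ?_ + ?_
  · rw [div_le_div_iff₀ hD hδ, Finset.sum_mul, one_mul]
    refine Finset.sum_le_sum fun j _ => ?_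
    have h := hp j
    have : (∑ e, c e j) / (p j + δ) ^ 2 * δ ≤ 1 / (p j + δ) ^ 2 * δ := by
      gcongr; exact hc j
    refine this.trans ?_
    rw [div_sub_div _ _ h.ne' (by positivity), div_mul_eq_mul_div, div_le_div_iff₀ (by positivity) (by positivity)]
    nlinarith [mul_pos hδ (mul_pos hδ (add_pos h hδ))]
  · refine Finset.sum_le_sum fun j _ => ?_
    have h := hp j
    have := hc j
    gcongr; linarith

lemma bss_lower_s18 {J E : Type*} [Fintype J] [Fintype E] (p : J → ℝ) (c : E → J → ℝ)
    (hp : ∀ j, 1 < p j) (hc : ∀ j, ∑ e, c e j = 1) (hs : ∑ j, 1 / p j ≤ 1)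
    (hD : 0 < ∑ j, (1 / (p j - 1) - 1 / p j)) :
    1 - ∑ j, 1 / p j ≤
    ∑ e, ((∑ j, c e j / (p j - 1) ^ 2) / (∑ j, (1 / (p j - 1) - 1 / p j))
      - ∑ j, c e j / (p j - 1)) := by
  have hx : ∀ j, 1 / (p j - 1) - 1 / p j = 1 / (p j - 1) * (1 / p j) := fun j => by
    have h1 : p j - 1 ≠ 0 := by linarith [hp j]
    have h2 : p j ≠ 0 := by linarith [hp j]
    field_simp; ring
  set D := ∑ j, (1 / (p j - 1) - 1 / p j) with hDdef
  rw [Finset.sum_sub_distrib, ← Finset.sum_div, Finset.sum_comm,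
    Finset.sum_comm (f := fun e j => c e j / (p j - 1))]
  simp_rw [← Finset.sum_div, hc]
  have hD1 : D = ∑ j, 1 / (p j - 1) - ∑ j, 1 / p j := by rw [hDdef, Finset.sum_sub_distrib]
  have hD2 : D = ∑ j, 1 / (p j - 1) * (1 / p j) := Finset.sum_congr rfl fun j _ => hx j
  have hcs : D ^ 2 ≤ (∑ j, 1 / (p j - 1) ^ 2 * (1 / p j)) * ∑ j, 1 / p j := by
    rw [hD2]
    have hp0 : ∀ j, 0 < p j := fun j => by linarith [hp j]
    refine Finset.sum_sq_le_sum_mul_sum_of_sq_le_mul _ ?_ ?_ ?_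
    · intro j _; have := hp0 j; positivity
    · intro j _; have := hp0 j; positivity
    · intro j _; apply le_of_eq; generalize p j - 1 = z; ring
  have h0 : 0 ≤ ∑ j, 1 / (p j - 1) ^ 2 * (1 / p j) :=
    Finset.sum_nonneg fun j _ => by have := hp j; positivity
  have hS : ∑ j, 1 / (p j - 1) ^ 2 - D = ∑ j, 1 / (p j - 1) ^ 2 * (1 / p j) := by
    rw [hD2, ← Finset.sum_sub_distrib]
    refine Finset.sum_congr rfl fun j _ => ?_
    have := hx j
    generalize p j - 1 = z at *
    calc _ = 1 / z * (1 / z - 1 / p j) := by ring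
      _ = _ := by rw [this]; ring
  have key : 1 + D ≤ (∑ j, 1 / (p j - 1) ^ 2) / D := by
    rw [le_div_iff₀ hD]
    nlinarith [mul_le_mul_of_nonneg_left hs h0]
  linarith

/-- The barrier invariant. -/
def BssInv {ι κ : Type*} [Fintype ι] [DecidableEq ι] [Fintype κ] (η : ℝ)
    (A : Matrix ι ι ℝ) (y : κ → ℝ) (u l : ℝ) : Prop :=
  (u • (1 : Matrix ι ι ℝ) - A).PosDef ∧ (A - l • (1 : Matrix ι ι ℝ)).PosDef ∧ (∀ k, y k < u) ∧
  trace (u • (1 : Matrix ι ι ℝ) - A)⁻¹ + ∑ k, 1 / (u - y k) ≤ η ∧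
  trace (A - l • (1 : Matrix ι ι ℝ))⁻¹ ≤ η

lemma bss_step_diag {ι κ E : Type*} [Fintype ι] [DecidableEq ι] [Nonempty ι] [Fintype κ]
    [Fintype E] (a : E → ι → ℝ) (b : E → κ → ℝ) (hb : ∀ e k, 0 ≤ b e k)
    (hB : ∀ k, ∑ e, b e k ≤ 1) (ha : ∀ i, ∑ e, a e i ^ 2 = 1)
    (η δ u l : ℝ) (hη1 : η < 1) (hδ : 0 < δ) (hηδ : 1 / δ + 2 * η < 1)
    (lam : ι → ℝ) (y : κ → ℝ) (h1 : ∀ i, lam i < u) (h2 : ∀ i, l < lam i) (h3 : ∀ k, y k < u)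
    (h4 : ∑ i, 1 / (u - lam i) + ∑ k, 1 / (u - y k) ≤ η) (h5 : ∑ i, 1 / (lam i - l) ≤ η) :
    ∃ e : E, ∃ s : ℝ, 0 < s ∧
      BssInv η (diagonal lam + s • vecMulVec (a e) (a e)) (fun k => y k + s * b e k)
        (u + δ) (l + 1) := by
  have hp1 : ∀ i, 1 < lam i - l := by
    intro i
    have h0 : 0 < lam i - l := by linarith [h2 i]
    have : 1 / (lam i - l) ≤ ∑ i, 1 / (lam i - l) :=
      Finset.single_le_sum (f := fun i => 1 / (lam i - l))
        (fun j _ => by have := h2 j; have : 0 < lam j - l := by linarith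
                       positivity) (Finset.mem_univ i)
    have h6 : 1 / (lam i - l) < 1 := by linarith
    rwa [div_lt_one h0] at h6
  -- lower
  set DL := ∑ i, (1 / (lam i - l - 1) - 1 / (lam i - l)) with hDL
  have hDLpos : 0 < DL := by
    refine Finset.sum_pos (fun i _ => ?_) Finset.univ_nonempty
    have := hp1 i
    rw [sub_pos]
    exact one_div_lt_one_div_of_lt (by linarith) (by linarith)
  have hlow := bss_lower_s18 (fun i => lam i - l) (fun e i => a e i ^ 2) hp1 ha (by linarith) hDLpos
  -- upper
  have hpu : ∀ j, 0 < (Sum.elim (fun i => u - lam i) (fun k => u - y k) : ι ⊕ κ → ℝ) j := by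
    rintro (i | k)
    · simpa using h1 i
    · simpa using h3 k
  set DU := ∑ i, (1 / (u - lam i) - 1 / (u - lam i + δ))
    + ∑ k, (1 / (u - y k) - 1 / (u - y k + δ)) with hDU
  have hDUpos : 0 < DU := by
    refine add_pos_of_pos_of_nonneg
      (Finset.sum_pos (fun i _ => ?_) Finset.univ_nonempty) (Finset.sum_nonneg fun k _ => ?_)
    · have := h1 i
      rw [sub_pos]
      exact one_div_lt_one_div_of_lt (by linarith) (by linarith)
    · have := h3 k
      rw [sub_nonneg]
      exact one_div_le_one_div_of_le (by linarith) (by linarith)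
  have hup := bss_upper_s18 (Sum.elim (fun i => u - lam i) (fun k => u - y k) : ι ⊕ κ → ℝ)
    (fun e => Sum.elim (fun i => a e i ^ 2) (fun k => b e k)) δ hδ hpu
    (by rintro (i | k)
        · simpa using (ha i).le
        · simpa using hB k)
    (by simpa only [Fintype.sum_sum_type, Sum.elim_inl, Sum.elim_inr] using hDUpos)
  simp only [Fintype.sum_sum_type, Sum.elim_inl, Sum.elim_inr] at hup
  rw [← hDU] at hup
  rw [← hDL] at hlow
  obtain ⟨e, -, he⟩ := Finset.exists_lt_of_sum_lt (hup.trans_lt (lt_of_lt_of_le (by linarith) hlow))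
  set R := ∑ i, a e i ^ 2 / (u - lam i + δ) with hR
  set ρ := ∑ k, b e k / (u - y k + δ) with hρ
  set Qm := ∑ i, a e i ^ 2 / (u - lam i + δ) ^ 2 with hQm
  set Qs := ∑ k, b e k / (u - y k + δ) ^ 2 with hQs
  set r := ∑ i, a e i ^ 2 / (lam i - l - 1) with hr
  set q := ∑ i, a e i ^ 2 / (lam i - l - 1) ^ 2 with hq
  have hR0 : 0 ≤ R := Finset.sum_nonneg fun i _ => by
    have : 0 < u - lam i + δ := by linarith [h1 i]
    positivity
  have hρ0 : 0 ≤ ρ := Finset.sum_nonneg fun k _ => by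
    have : 0 < u - y k + δ := by linarith [h3 k]
    have := hb e k
    positivity
  have hQm0 : 0 ≤ Qm := Finset.sum_nonneg fun i _ => by positivity
  have hQs0 : 0 ≤ Qs := Finset.sum_nonneg fun k _ => by
    have := hb e k
    positivity
  have hr0 : 0 ≤ r := Finset.sum_nonneg fun i _ => by
    have : 0 < lam i - l - 1 := by linarith [hp1 i]
    positivity
  have hL : 0 < q / DL - r := lt_of_le_of_lt (by positivity) he
  set L := q / DL - r with hLdef
  have hs : 0 < 1 / L := by positivity
  refine ⟨e, 1 / L, hs, ?_⟩
  set s := 1 / L with hsdef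
  have hsL : s * L = 1 := by rw [hsdef]; field_simp
  have hsU : s * ((Qm + Qs) / DU + (R + ρ)) < 1 := by
    rw [← hsL]; exact mul_lt_mul_of_pos_left he hs
  have hQD : 0 ≤ s * ((Qm + Qs) / DU) := by positivity
  have hsRρ : s * (R + ρ) < 1 := by linarith
  have hbig : s * (Qm + Qs) / (1 - s * (R + ρ)) ≤ DU := by
    rw [div_le_iff₀ (by linarith)]
    have : s * (Qm + Qs) = s * ((Qm + Qs) / DU) * DU := by field_simp
    rw [this, mul_comm DU]
    exact mul_le_mul_of_nonneg_right (by linarith) hDUpos.le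
  have hsρ : 0 ≤ s * ρ := by positivity
  have hsR : 0 ≤ s * R := by positivity
  have hE1 : (u + δ) • (1 : Matrix ι ι ℝ) - (diagonal lam + s • vecMulVec (a e) (a e))
      = diagonal (fun i => u - lam i + δ) + (-s) • vecMulVec (a e) (a e) := by
    ext i j
    by_cases h : i = j
    · subst h; simp; ring
    · simp [h]
  have hE2 : (diagonal lam + s • vecMulVec (a e) (a e)) - (l + 1) • (1 : Matrix ι ι ℝ)
      = diagonal (fun i => lam i - l - 1) + s • vecMulVec (a e) (a e) := by
    ext i j
    by_cases h : i = j
    · subst h; simp; ring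
    · simp [h]
  obtain ⟨hU1, hU2⟩ := bss_rank1 (fun i => u - lam i + δ) (a e) (-s)
    (fun i => by linarith [h1 i]) (by rw [← hR]; linarith)
  obtain ⟨hL1, hL2⟩ := bss_rank1 (fun i => lam i - l - 1) (a e) s
    (fun i => by linarith [hp1 i]) (by rw [← hr]; positivity)
  have hbk : ∀ k, s * (b e k / (u - y k + δ)) ≤ s * ρ := by
    intro k
    refine mul_le_mul_of_nonneg_left ?_ hs.le
    exact Finset.single_le_sum (f := fun k => b e k / (u - y k + δ))
        (fun j _ => by have : 0 < u - y j + δ := by linarith [h3 j]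
                       have := hb e j
                       positivity) (Finset.mem_univ k)
  have hyk : ∀ k, y k + s * b e k < u + δ := by
    intro k
    have h0 : 0 < u - y k + δ := by linarith [h3 k]
    have h6 := (hbk k).trans_lt (by linarith : s * ρ < 1)
    rw [← mul_div_assoc, div_lt_one h0] at h6
    linarith
  refine ⟨hE1 ▸ hU1, hE2 ▸ hL1, hyk, ?_, ?_⟩
  · rw [hE1, hU2, ← hR, ← hQm]
    have hsc : ∀ k, 1 / (u + δ - (y k + s * b e k)) ≤
        1 / (u - y k + δ) + s * (b e k / (u - y k + δ) ^ 2) / (1 - s * (R + ρ)) := by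
      intro k
      have h0 : 0 < u - y k + δ := by linarith [h3 k]
      have h6 := hyk k
      have h7 := hbk k
      have h8 : 0 < 1 - s * (b e k / (u - y k + δ)) := by linarith
      have heq : 1 / (u + δ - (y k + s * b e k)) = 1 / (u - y k + δ)
          + s * (b e k / (u - y k + δ) ^ 2) / (1 - s * (b e k / (u - y k + δ))) := by
        have e1 : u + δ - (y k + s * b e k) =
          (u - y k + δ) * (1 - s * (b e k / (u - y k + δ))) := by field_simp; ring
        rw [e1]
        generalize u - y k + δ = z at *
        have := h0.ne'
        have e2 : s * (b e k / z ^ 2) = (1 - (1 - s * (b e k / z))) / z := by field_simp; ring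
        rw [e2]
        generalize 1 - s * (b e k / z) = t at *
        field_simp
        ring
      rw [heq]
      have h9 : 0 ≤ s * (b e k / (u - y k + δ) ^ 2) := by have := hb e k; positivity
      have h10 := div_le_div_of_nonneg_left h9 (by linarith : 0 < 1 - s * (R + ρ))
        (by linarith : 1 - s * (R + ρ) ≤ 1 - s * (b e k / (u - y k + δ)))
      linarith
    have hsum := Finset.sum_le_sum fun k (_ : k ∈ Finset.univ) => hsc k
    rw [Finset.sum_add_distrib, ← Finset.sum_div, ← Finset.mul_sum, ← hQs] at hsum
    have hm : s * Qm / (1 - s * R) ≤ s * Qm / (1 - s * (R + ρ)) :=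
      div_le_div_of_nonneg_left (by positivity) (by linarith) (by linarith)
    have hadd : s * (Qm + Qs) / (1 - s * (R + ρ)) =
      s * Qm / (1 - s * (R + ρ)) + s * Qs / (1 - s * (R + ρ)) := by ring
    have hneg : (-s) * Qm / (1 + -s * R) = - (s * Qm / (1 - s * R)) := by
      rw [show 1 + -s * R = 1 - s * R by ring]; ring
    rw [hneg]
    rw [Finset.sum_sub_distrib, Finset.sum_sub_distrib] at hDU
    linarith
  · rw [hE2, hL2, ← hr, ← hq]
    have : s * q / (1 + s * r) = DL := by
      rw [div_eq_iff (by positivity)]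
      have : q = (L + r) * DL := by rw [hLdef]; field_simp; ring
      rw [this]; linear_combination DL * hsL
    rw [this, hDL, Finset.sum_sub_distrib]
    linarith

lemma bss_inv_conj {ι κ : Type*} [Fintype ι] [DecidableEq ι] [Fintype κ] (η : ℝ)
    (A Q : Matrix ι ι ℝ) (hQ1 : Qᵀ * Q = 1) (y : κ → ℝ) (u l : ℝ)
    (h : BssInv η A y u l) : BssInv η (Q * A * Qᵀ) y u l := by
  have hQ2 : Q * Qᵀ = 1 := mul_eq_one_comm.mp hQ1
  have hU : IsUnit Q := ⟨⟨Q, Qᵀ, hQ2, hQ1⟩, rfl⟩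
  have tr : ∀ M : Matrix ι ι ℝ, M.PosDef → (Q * M * Qᵀ).PosDef ∧
      trace (Q * M * Qᵀ)⁻¹ = trace M⁻¹ := by
    intro M hM
    constructor
    · have := (Matrix.IsUnit.posDef_star_right_conjugate_iff (x := M) hU).2 hM
      simpa [Matrix.star_eq_conjTranspose] using this
    · have hdet : IsUnit M.det := (Matrix.isUnit_iff_isUnit_det M).1 hM.isUnit
      have : (Q * M * Qᵀ)⁻¹ = Q * M⁻¹ * Qᵀ := by
        apply inv_eq_right_inv
        calc Q * M * Qᵀ * (Q * M⁻¹ * Qᵀ) = Q * M * (Qᵀ * Q) * M⁻¹ * Qᵀ := by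
              simp only [Matrix.mul_assoc]
          _ = Q * (M * M⁻¹) * Qᵀ := by rw [hQ1, Matrix.mul_one, Matrix.mul_assoc Q]
          _ = 1 := by rw [Matrix.mul_nonsing_inv _ hdet, Matrix.mul_one, hQ2]
      rw [this, trace_mul_cycle, hQ1, Matrix.one_mul]
  have e1 : u • (1 : Matrix ι ι ℝ) - Q * A * Qᵀ = Q * (u • (1 : Matrix ι ι ℝ) - A) * Qᵀ := by
    rw [mul_sub, sub_mul, Matrix.mul_smul, Matrix.smul_mul, Matrix.mul_one, hQ2]
  have e2 : Q * A * Qᵀ - l • (1 : Matrix ι ι ℝ) = Q * (A - l • (1 : Matrix ι ι ℝ)) * Qᵀ := by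
    rw [mul_sub, sub_mul, Matrix.mul_smul, Matrix.smul_mul, Matrix.mul_one, hQ2]
  obtain ⟨h1, h2, h3, h4, h5⟩ := h
  refine ⟨?_, ?_, h3, ?_, ?_⟩
  · rw [e1]; exact (tr _ h1).1
  · rw [e2]; exact (tr _ h2).1
  · rw [e1, (tr _ h1).2]; exact h4
  · rw [e2, (tr _ h2).2]; exact h5

lemma bss_step_s18 {ι κ E : Type*} [Fintype ι] [DecidableEq ι] [Nonempty ι] [Fintype κ]
    [Fintype E] (a : E → ι → ℝ) (b : E → κ → ℝ) (hb : ∀ e k, 0 ≤ b e k)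
    (hB : ∀ k, ∑ e, b e k ≤ 1) (ha : ∑ e, vecMulVec (a e) (a e) = 1)
    (η δ u l : ℝ) (hη1 : η < 1) (hδ : 0 < δ) (hηδ : 1 / δ + 2 * η < 1)
    (A : Matrix ι ι ℝ) (y : κ → ℝ) (h : BssInv η A y u l) :
    ∃ e : E, ∃ s : ℝ, 0 < s ∧
      BssInv η (A + s • vecMulVec (a e) (a e)) (fun k => y k + s * b e k)
        (u + δ) (l + 1) := by
  have hA : A.IsHermitian := by
    have := h.2.1.isHermitian
    have h2 : (l • (1 : Matrix ι ι ℝ)).IsHermitian := by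
      simp [Matrix.IsHermitian]
    simpa using this.add h2
  obtain ⟨Q, lam, hQ1, hQ2, hAQ⟩ := bss_diag_exists A hA
  have hD : BssInv η (diagonal lam) y u l := by
    have := bss_inv_conj η A Qᵀ (by simpa using hQ2) y u l h
    have e : Qᵀ * A * Qᵀᵀ = diagonal lam := by
      rw [hAQ, transpose_transpose]
      calc Qᵀ * (Q * diagonal lam * Qᵀ) * Q = (Qᵀ * Q) * diagonal lam * (Qᵀ * Q) := by
            simp only [Matrix.mul_assoc]
        _ = _ := by rw [hQ1]; simp
    rwa [e] at this
  have e1 : u • (1 : Matrix ι ι ℝ) - diagonal lam = diagonal (fun i => u - lam i) := by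
    rw [← diagonal_one, ← diagonal_smul, diagonal_sub]; simp
  have e2 : diagonal lam - l • (1 : Matrix ι ι ℝ) = diagonal (fun i => lam i - l) := by
    rw [← diagonal_one, ← diagonal_smul, diagonal_sub]; simp
  obtain ⟨g1, g2, g3, g4, g5⟩ := hD
  rw [e1] at g1 g4
  rw [e2] at g2 g5
  have p1 : ∀ i, 0 < u - lam i := fun i => by simpa using g1.diag_pos (i := i)
  have p2 : ∀ i, 0 < lam i - l := fun i => by simpa using g2.diag_pos (i := i)
  have tr : ∀ d : ι → ℝ, (∀ i, 0 < d i) → trace (diagonal d)⁻¹ = ∑ i, 1 / d i := by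
    intro d hd
    have := (bss_rank1 d 0 0 hd (by simp)).2
    simpa using this
  rw [tr _ p1] at g4
  rw [tr _ p2] at g5
  have ha' : ∑ e, vecMulVec (Qᵀ *ᵥ a e) (Qᵀ *ᵥ a e) = 1 := by
    have : ∀ e, vecMulVec (Qᵀ *ᵥ a e) (Qᵀ *ᵥ a e) = Qᵀ * vecMulVec (a e) (a e) * Q := by
      intro e
      rw [mul_vecMulVec, vecMulVec_mul, ← mulVec_transpose]
    simp_rw [this]
    rw [← Finset.sum_mul, ← Finset.mul_sum, ha, Matrix.mul_one, hQ1]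
  obtain ⟨e, s, hs, hI⟩ := bss_step_diag (fun e => Qᵀ *ᵥ a e) b hb hB
    (fun i => by
      have := congrFun (congrFun ha' i) i
      rw [Matrix.sum_apply] at this
      simpa [vecMulVec_apply, sq] using this)
    η δ u l hη1 hδ hηδ lam y (fun i => by linarith [p1 i]) (fun i => by linarith [p2 i]) g3 g4 g5
  refine ⟨e, s, hs, ?_⟩
  have := bss_inv_conj η _ Q hQ1 _ _ _ hI
  have e3 : Q * (diagonal lam + s • vecMulVec (Qᵀ *ᵥ a e) (Qᵀ *ᵥ a e)) * Qᵀ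
      = A + s • vecMulVec (a e) (a e) := by
    rw [mul_add, add_mul, ← hAQ, Matrix.mul_smul, Matrix.smul_mul, mul_vecMulVec, vecMulVec_mul,
      mulVec_mulVec, hQ2, one_mulVec, vecMul_transpose, mulVec_mulVec, hQ2, one_mulVec]
  rwa [e3] at this

lemma bss_core {ι κ E : Type*} [Fintype ι] [DecidableEq ι] [Nonempty ι] [Fintype κ]
    [Fintype E] [DecidableEq E] (a : E → ι → ℝ) (b : E → κ → ℝ) (hb : ∀ e k, 0 ≤ b e k)
    (hB : ∀ k, ∑ e, b e k ≤ 1) (ha : ∑ e, vecMulVec (a e) (a e) = 1)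
    (N η : ℝ) (hN : 0 < N) (hη : 0 < η) (hη1 : η < 1 / 4)
    (hι : (Fintype.card ι : ℝ) ≤ N) (hκ : (Fintype.card κ : ℝ) ≤ N) (T : ℕ) :
    ∃ c : E → ℝ, (∀ e, 0 ≤ c e) ∧ (Finset.univ.filter fun e => c e ≠ 0).card ≤ T ∧
      BssInv η (∑ e, c e • vecMulVec (a e) (a e)) (fun k => ∑ e, c e * b e k)
        (2 * N / η + T * (1 + 4 * η)) (- N / η + T) := by
  induction T with
  | zero =>
    refine ⟨fun _ => 0, fun _ => le_rfl, by simp, ?_⟩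
    have hu : 0 < 2 * N / η := by positivity
    have hl : 0 < N / η := by positivity
    have key : ∀ t : ℝ, 0 < t → (t • (1 : Matrix ι ι ℝ)).PosDef ∧
        trace (t • (1 : Matrix ι ι ℝ))⁻¹ = Fintype.card ι / t := by
      intro t ht
      have := bss_rank1 (fun _ : ι => t) 0 0 (fun _ => ht) (by simp)
      have e : diagonal (fun _ : ι => t) = t • (1 : Matrix ι ι ℝ) := by
        rw [← diagonal_one, ← diagonal_smul]; congr 1; ext; simp
      rw [e] at this
      simpa [div_eq_mul_inv] using this
    have e1 : - ((- N / η) • (1 : Matrix ι ι ℝ)) = (N / η) • 1 := by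
      rw [← neg_smul]; congr 1; ring
    simp only [zero_smul, Finset.sum_const_zero, zero_mul, CharP.cast_eq_zero, add_zero]
    refine ⟨?_, ?_, fun _ => hu, ?_, ?_⟩
    · rw [sub_zero]; exact (key _ hu).1
    · rw [zero_sub, e1]; exact (key _ hl).1
    · rw [sub_zero, (key _ hu).2]
      simp only [sub_zero, Finset.sum_const, Finset.card_univ, nsmul_eq_mul]
      rw [mul_one_div, ← add_div, div_le_iff₀ hu]
      have : η * (2 * N / η) = 2 * N := by field_simp
      linarith
    · rw [zero_sub, e1, (key _ hl).2, div_le_iff₀ hl]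
      have : η * (N / η) = N := by field_simp
      linarith
  | succ T ih =>
    obtain ⟨c, hc0, hcT, hI⟩ := ih
    obtain ⟨e, s, hs, hI'⟩ := bss_step_s18 a b hb hB ha η (1 + 4 * η) _ _ (by linarith) (by linarith)
      (by rw [← lt_sub_iff_add_lt, div_lt_iff₀ (by linarith)]; nlinarith) _ _ hI
    refine ⟨fun e' => c e' + if e' = e then s else 0, fun e' => ?_, ?_, ?_⟩
    · have := hc0 e'
      dsimp only; split_ifs <;> linarith
    · refine (Finset.card_le_card (t := insert e (Finset.univ.filter fun e => c e ≠ 0)) ?_).trans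
        ((Finset.card_insert_le _ _).trans (by omega))
      intro e' he'
      simp only [Finset.mem_filter, Finset.mem_univ, true_and, Finset.mem_insert] at he' ⊢
      by_cases h : e' = e
      · exact Or.inl h
      · right; simpa [h] using he'
    · simp only [add_smul, add_mul, Finset.sum_add_distrib, ite_smul, zero_smul, ite_mul, zero_mul,
        Finset.sum_ite_eq', Finset.mem_univ, if_true]
      convert hI' using 1
      · push_cast; ring
      · push_cast; ring

lemma bss_final {ι κ E : Type*} [Fintype ι] [DecidableEq ι] [Nonempty ι] [Fintype κ]
    [Fintype E] [DecidableEq E] (a : E → ι → ℝ) (b : E → κ → ℝ) (hb : ∀ e k, 0 ≤ b e k)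
    (hB : ∀ k, ∑ e, b e k ≤ 1) (ha : ∑ e, vecMulVec (a e) (a e) = 1)
    (N η : ℝ) (hN : 0 < N) (hη : 0 < η) (hη1 : η < 1 / 4)
    (hι : (Fintype.card ι : ℝ) ≤ N) (hκ : (Fintype.card κ : ℝ) ≤ N) (T : ℕ)
    (hT : N / η ^ 2 ≤ T) :
    ∃ c : E → ℝ, (∀ e, 0 ≤ c e) ∧ (Finset.univ.filter fun e => c e ≠ 0).card ≤ T ∧
      (∀ z : ι → ℝ, (1 - η) * ∑ e, (a e ⬝ᵥ z) ^ 2 ≤ ∑ e, c e * (a e ⬝ᵥ z) ^ 2 ∧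
        ∑ e, c e * (a e ⬝ᵥ z) ^ 2 ≤ (1 + 6 * η) * ∑ e, (a e ⬝ᵥ z) ^ 2) ∧
      ∀ k, ∑ e, c e * b e k ≤ 1 + 6 * η := by
  obtain ⟨c, hc0, hcT, g1, g2, g3, -, -⟩ := bss_core a b hb hB ha N η hN hη hη1 hι hκ T
  have hT0 : (0 : ℝ) < T := lt_of_lt_of_le (by positivity) hT
  have hNT : N / η ≤ η * T := by
    rw [div_le_iff₀ (by positivity)] at hT
    rw [div_le_iff₀ hη]; linarith
  have hquad : ∀ (c : E → ℝ) (z : ι → ℝ),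
      z ⬝ᵥ ((∑ e, c e • vecMulVec (a e) (a e)) *ᵥ z) = ∑ e, c e * (a e ⬝ᵥ z) ^ 2 := by
    intro c z
    rw [Matrix.sum_mulVec, dotProduct_sum]
    refine Finset.sum_congr rfl fun e _ => ?_
    rw [smul_mulVec, dotProduct_smul, vecMulVec_mulVec, smul_eq_mul]
    simp only [op_smul_eq_smul, dotProduct_smul, smul_eq_mul]
    rw [dotProduct_comm z]; ring
  have hone : ∀ z : ι → ℝ, z ⬝ᵥ z = ∑ e, (a e ⬝ᵥ z) ^ 2 := by
    intro z
    have := hquad (fun _ => 1) z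
    simpa [ha] using this.symm.symm
  have hu : 2 * N / η + T * (1 + 4 * η) ≤ T * (1 + 6 * η) := by
    have : 2 * N / η = 2 * (N / η) := by ring
    rw [this]; linarith
  have hl : T * (1 - η) ≤ - N / η + T := by
    have : - N / η = - (N / η) := by ring
    rw [this]; linarith
  refine ⟨fun e => c e / T, fun e => div_nonneg (hc0 e) hT0.le, ?_, fun z => ?_, fun k => ?_⟩
  · refine le_trans (Finset.card_le_card ?_) hcT
    intro e he
    simp only [Finset.mem_filter, Finset.mem_univ, true_and] at he ⊢
    intro h; apply he; simp [h]
  · have q1 := g1.posSemidef.dotProduct_mulVec_nonneg z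
    have q2 := g2.posSemidef.dotProduct_mulVec_nonneg z
    rw [star_trivial, sub_mulVec, dotProduct_sub, smul_mulVec, one_mulVec, dotProduct_smul,
      hquad, hone, smul_eq_mul] at q1 q2
    have hz : 0 ≤ ∑ e, (a e ⬝ᵥ z) ^ 2 := Finset.sum_nonneg fun _ _ => sq_nonneg _
    have e1 : ∑ e, c e / T * (a e ⬝ᵥ z) ^ 2 = (∑ e, c e * (a e ⬝ᵥ z) ^ 2) / T := by
      rw [Finset.sum_div]; exact Finset.sum_congr rfl fun e _ => by ring
    rw [e1, le_div_iff₀ hT0, div_le_iff₀ hT0]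
    have r1 := mul_le_mul_of_nonneg_right hu hz
    have r2 := mul_le_mul_of_nonneg_right hl hz
    constructor <;> linarith
  · have e1 : ∑ e, c e / T * b e k = (∑ e, c e * b e k) / T := by
      rw [Finset.sum_div]; exact Finset.sum_congr rfl fun e _ => by ring
    rw [e1, div_le_iff₀ hT0]
    have := g3 k
    linarith

lemma bss_isotropic_s18 {n : ℕ} {E : Type*} [Fintype E] (v : E → Fin n → ℝ) :
    ∃ (S : Finset (Fin n)) (a : E → S → ℝ), ∑ e, vecMulVec (a e) (a e) = 1 ∧
      ∀ x : Fin n → ℝ, ∃ z : S → ℝ, ∀ e, a e ⬝ᵥ z = v e ⬝ᵥ x := by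
  set L := ∑ e, vecMulVec (v e) (v e) with hL
  have hH : L.IsHermitian := by
    rw [hL, Matrix.IsHermitian, conjTranspose_sum]
    refine Finset.sum_congr rfl fun e _ => ?_
    simp
  obtain ⟨Q, lam, hQ1, hQ2, hLQ⟩ := bss_diag_exists L hH
  have hg : ∀ i j, ∑ e, (Qᵀ *ᵥ v e) i * (Qᵀ *ᵥ v e) j = diagonal lam i j := by
    intro i j
    have h1 : ∑ e, vecMulVec (Qᵀ *ᵥ v e) (Qᵀ *ᵥ v e) = diagonal lam := by
      have : ∀ e, vecMulVec (Qᵀ *ᵥ v e) (Qᵀ *ᵥ v e) = Qᵀ * vecMulVec (v e) (v e) * Q := by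
        intro e
        rw [mul_vecMulVec, vecMulVec_mul, ← mulVec_transpose]
      simp_rw [this]
      rw [← Finset.sum_mul, ← Finset.mul_sum, ← hL, hLQ]
      calc Qᵀ * (Q * diagonal lam * Qᵀ) * Q = (Qᵀ * Q) * diagonal lam * (Qᵀ * Q) := by
            simp only [Matrix.mul_assoc]
        _ = _ := by rw [hQ1]; simp
    rw [← h1, Matrix.sum_apply]; rfl
  have hlam : ∀ i, ∑ e, (Qᵀ *ᵥ v e) i ^ 2 = lam i := by
    intro i; have := hg i i; simpa [sq] using this
  have hlam0 : ∀ i, 0 ≤ lam i := fun i => by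
    rw [← hlam i]; exact Finset.sum_nonneg fun _ _ => sq_nonneg _
  have hgz : ∀ i, lam i = 0 → ∀ e, (Qᵀ *ᵥ v e) i = 0 := by
    intro i hi e
    rw [← hlam i, Finset.sum_eq_zero_iff_of_nonneg fun _ _ => sq_nonneg _] at hi
    simpa using hi e (Finset.mem_univ _)
  refine ⟨Finset.univ.filter fun i => lam i ≠ 0,
    fun e i => (Qᵀ *ᵥ v e) i / √(lam i), ?_, fun x => ⟨fun i => √(lam i) * (Qᵀ *ᵥ x) i, fun e => ?_⟩⟩
  · ext i j
    have hi : 0 < lam i := lt_of_le_of_ne (hlam0 i) (Ne.symm (Finset.mem_filter.mp i.2).2)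
    rw [Matrix.sum_apply]
    simp only [vecMulVec_apply]
    have : ∀ e, (Qᵀ *ᵥ v e) i / √(lam i) * ((Qᵀ *ᵥ v e) j / √(lam j))
        = ((Qᵀ *ᵥ v e) i * (Qᵀ *ᵥ v e) j) / (√(lam i) * √(lam j)) := fun e => by
      rw [div_mul_div_comm]
    simp_rw [this]
    rw [← Finset.sum_div, hg]
    by_cases h : i = j
    · subst h
      rw [diagonal_apply_eq, Real.mul_self_sqrt hi.le, div_self hi.ne', one_apply_eq]
    · rw [diagonal_apply_ne _ (fun h' => h (Subtype.ext h')), zero_div, one_apply_ne h]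
  · have h1 : v e ⬝ᵥ x = (Qᵀ *ᵥ v e) ⬝ᵥ (Qᵀ *ᵥ x) := by
      rw [dotProduct_mulVec, vecMul_transpose, mulVec_mulVec, hQ2, one_mulVec]
    rw [h1]
    simp only [dotProduct]
    rw [← Finset.sum_filter_of_ne (s := Finset.univ) (p := fun i => lam i ≠ 0)]
    · rw [← Finset.sum_coe_sort (Finset.univ.filter fun i => lam i ≠ 0)]
      refine Finset.sum_congr rfl fun i _ => ?_
      have hi : 0 < lam i := lt_of_le_of_ne (hlam0 i) (Ne.symm (Finset.mem_filter.mp i.2).2)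
      have := (Real.sqrt_pos.2 hi).ne'
      field_simp
    · intro i _ h hl
      apply h; rw [hgz i hl e, zero_mul]

lemma bss_vectors {n : ℕ} {E : Type*} [Fintype E] [DecidableEq E] (v : E → Fin n → ℝ)
    (b : E → Fin n → ℝ) (hb : ∀ e k, 0 ≤ b e k) (hB : ∀ k, ∑ e, b e k ≤ 1)
    (η : ℝ) (hn : 0 < n) (hη : 0 < η) (hη1 : η < 1 / 4) (T : ℕ)
    (hT : (n : ℝ) / η ^ 2 ≤ T) :
    ∃ c : E → ℝ, (∀ e, 0 ≤ c e) ∧ (Finset.univ.filter fun e => c e ≠ 0).card ≤ T ∧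
      (∀ x : Fin n → ℝ, (1 - η) * ∑ e, (v e ⬝ᵥ x) ^ 2 ≤ ∑ e, c e * (v e ⬝ᵥ x) ^ 2 ∧
        ∑ e, c e * (v e ⬝ᵥ x) ^ 2 ≤ (1 + 6 * η) * ∑ e, (v e ⬝ᵥ x) ^ 2) ∧
      ∀ k, ∑ e, c e * b e k ≤ 1 + 6 * η := by
  obtain ⟨S, a, ha, hx⟩ := bss_isotropic_s18 v
  rcases isEmpty_or_nonempty S with hS | hS
  · refine ⟨fun _ => 0, fun _ => le_rfl, by simp, fun x => ?_, fun k => ?_⟩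
    · obtain ⟨z, hz⟩ := hx x
      simp_rw [← hz]
      simp [dotProduct]
    · simp; linarith
  · obtain ⟨c, h1, h2, h3, h4⟩ := bss_final a b hb hB ha n η (by exact_mod_cast hn) hη hη1
      (by have := Finset.card_le_univ S
          simp only [Fintype.card_coe, Fintype.card_fin] at this ⊢
          exact_mod_cast this) (by simp) T hT
    refine ⟨c, h1, h2, fun x => ?_, h4⟩
    obtain ⟨z, hz⟩ := hx x
    simp_rw [← hz]
    exact h3 z

lemma bss_sum_ext {α : Type*} [Fintype α] (P : α → Prop) [DecidablePred P]
    (c : {e // P e} → ℝ) (F : α → ℝ) :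
    ∑ e : α, (if h : P e then c ⟨e, h⟩ else 0) * F e = ∑ e : {e // P e}, c e * F e := by
  rw [← Finset.sum_filter_of_ne (s := Finset.univ) (p := P)]
  · rw [Finset.sum_subtype (p := P) _ (by simp)]
    refine Finset.sum_congr rfl fun e _ => ?_
    rw [dif_pos e.2]
  · intro e _ h
    by_contra hP
    exact h (by rw [dif_neg hP, zero_mul])

end Bss

/--
**existence of spectral sparsifiers with bounded blow-up:
guarantee of `Sparsify2`, properties Y.1–Y.4.**
There is an absolute constant `c` such that for every `n`, every
`ε ∈ (1/n, 1/3)`, every `p ∈ (0,1/2)`, and every weighted graph `G = (V,E,w)`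
on `n` vertices in which every edge has weight at most `1`, there exists a
weighted graph `G̃ = (V,Ẽ,w̃)` with `Ẽ ⊆ E` such that `G̃` is a
`(1+ε)`-spectral approximation of `G`, `G̃` has at most
`c · ε⁻² · n · log₂³⁴(n/p)` edges, and every vertex has blow-up at most `2`:
for every `v`, `(1/d_v) Σ_u w̃(v,u)/w(v,u) ≤ 2`, where `d_v` is the number of
edges of `E` incident to `v`.  (The summand `w̃(v,u)/w(v,u)` is the blow-up of
the edge `(v,u)`: it is `0` whenever `(v,u) ∉ Ẽ`, and for `(v,u) ∉ E` both
weights vanish, so by the convention `0/0 = 0` non-edges contribute nothing.)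
-/
theorem stmt18 :
    ∃ c : ℝ, 0 < c ∧
      ∀ (n : ℕ) (ε p : ℝ), 1 / (n : ℝ) < ε → ε < 1 / 3 → 0 < p → p < 1 / 2 →
      ∀ w : Fin n → Fin n → ℝ,
        (∀ u v, w u v = w v u) → (∀ u v, 0 ≤ w u v) → (∀ v, w v v = 0) →
        (∀ u v, w u v ≤ 1) →
        ∃ wt : Fin n → Fin n → ℝ,
          (∀ u v, wt u v = wt v u) ∧ (∀ u v, 0 ≤ wt u v) ∧
          -- Ẽ ⊆ E
          (∀ u v, wt u v ≠ 0 → w u v ≠ 0) ∧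
          -- (1+ε)-spectral approximation
          (∀ x : Fin n → ℝ,
            (1 / (1 + ε)) * lapQ wt x ≤ lapQ w x ∧
              lapQ w x ≤ (1 + ε) * lapQ wt x) ∧
          -- number of edges
          (((Finset.univ.filter fun e : Fin n × Fin n =>
              e.1 < e.2 ∧ wt e.1 e.2 ≠ 0).card : ℝ) ≤
            c * ε⁻¹ ^ 2 * (n : ℝ) * Real.logb 2 ((n : ℝ) / p) ^ 34) ∧
          -- every vertex has blow-up at most 2
          (∀ v : Fin n,
            (1 / ((Finset.univ.filter fun u => w v u ≠ 0).card : ℝ)) *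
              (∑ u, wt v u / w v u) ≤ 2) := by
  refine ⟨37, by norm_num, ?_⟩
  intro n ε p hε1 hε2 hp0 hp1 w hsymm hnn hdiag hle
  rcases Nat.eq_zero_or_pos n with hn | hn
  · subst hn
    refine ⟨fun _ _ => 0, fun _ _ => rfl, fun _ _ => le_rfl, fun u => u.elim0, fun x => ?_, ?_,
      fun v => v.elim0⟩
    · simp [lapQ]
    · simp
  have hnR : (0 : ℝ) < n := by exact_mod_cast hn
  have hε : 0 < ε := lt_trans (by positivity) hε1
  -- the logarithm is at least one
  have hlog : 1 ≤ Real.logb 2 ((n : ℝ) / p) := by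
    rw [Real.le_logb_iff_rpow_le (by norm_num) (by positivity), Real.rpow_one, le_div_iff₀ hp0]
    have : (1 : ℝ) ≤ n := by exact_mod_cast hn
    linarith
  let P : Fin n × Fin n → Prop := fun e => e.1 < e.2 ∧ w e.1 e.2 ≠ 0
  classical
  let ext : ({e // P e} → ℝ) → Fin n × Fin n → ℝ := fun c e => if h : P e then c ⟨e, h⟩ else 0
  let d : Fin n → ℝ := fun v => ((Finset.univ.filter fun u => w v u ≠ 0).card : ℝ)
  let v : {e // P e} → Fin n → ℝ := fun e =>
    √(w e.1.1 e.1.2) • (Pi.single e.1.1 1 - Pi.single e.1.2 1)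
  let F : Fin n → Fin n × Fin n → ℝ := fun k e =>
    (if e.1 = k then 1 else 0) + (if e.2 = k then 1 else 0)
  let b : {e // P e} → Fin n → ℝ := fun e k => F k e.1 / d k
  let W : ({e // P e} → ℝ) → Fin n → Fin n → ℝ := fun c x y => (ext c (x, y) + ext c (y, x)) * w x y
  have hv : ∀ e x, (dotProduct (v e) x) ^ 2 = w e.1.1 e.1.2 * (x e.1.1 - x e.1.2) ^ 2 := by
    intro e x
    simp only [v, smul_dotProduct, sub_dotProduct, single_dotProduct, one_mul, smul_eq_mul]
    rw [mul_pow, Real.sq_sqrt (hnn _ _)]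
  have hext : ∀ (c : {e // P e} → ℝ) (G : Fin n × Fin n → ℝ),
      ∑ x, ∑ y, ext c (x, y) * G (x, y) = ∑ e, c e * G e.1 := by
    intro c G
    rw [← Fintype.sum_prod_type (f := fun e => ext c e * G e)]
    exact bss_sum_ext P c G
  have hlap : ∀ c x, lapQ (W c) x = ∑ e, c e * (dotProduct (v e) x) ^ 2 := by
    intro c x
    simp only [hv]
    rw [← hext c (fun e => w e.1 e.2 * (x e.1 - x e.2) ^ 2)]
    have h1 : ∀ i j, W c i j * (x i - x j) ^ 2 =
        ext c (i, j) * (w i j * (x i - x j) ^ 2) + ext c (j, i) * (w j i * (x j - x i) ^ 2) := by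
      intro i j
      simp only [W]
      rw [hsymm j i]; ring
    simp only [lapQ, h1, Finset.sum_add_distrib]
    rw [Finset.sum_comm (f := fun i j => ext c (j, i) * (w j i * (x j - x i) ^ 2))]
    ring
  have hone : ∀ x y, ext (fun _ => 1) (x, y) + ext (fun _ => 1) (y, x)
      = if w x y ≠ 0 then 1 else 0 := by
    intro x y
    simp only [ext, P]
    rcases lt_trichotomy x y with h | h | h
    · simp [h, h.not_gt]
    · subst h; simp [hdiag]
    · simp [h, h.not_gt, hsymm y x]
  have hW1 : W (fun _ => 1) = w := by
    ext x y
    simp only [W, hone]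
    by_cases h : w x y = 0 <;> simp [h]
  have hblow : ∀ (c : {e // P e} → ℝ) k,
      ∑ y, (ext c (k, y) + ext c (y, k)) = ∑ e, c e * F k e.1 := by
    intro c k
    rw [← hext c (F k)]
    simp only [F, mul_add, Finset.sum_add_distrib, mul_ite, mul_one, mul_zero]
    congr 1
    · rw [Finset.sum_comm]; simp
    · simp
  have hF : ∀ k e, 0 ≤ F k e := by
    intro k e
    simp only [F]
    split_ifs <;> norm_num
  have hd : ∀ k, ∑ e : {e // P e}, F k e.1 = d k := by
    intro k
    have := hblow (fun _ => 1) k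
    simp only [one_mul] at this
    rw [← this]
    simp only [hone, d]
    rw [Finset.sum_boole]
  have hb : ∀ e k, 0 ≤ b e k := fun e k => div_nonneg (hF _ _) (by simp [d])
  have hB : ∀ k, ∑ e, b e k ≤ 1 := by
    intro k
    simp only [b]
    rw [← Finset.sum_div, hd]
    exact div_self_le_one _
  obtain ⟨c, hc0, hcT, hcx, hck⟩ := bss_vectors v b hb hB (ε / 6) hn (by positivity) (by linarith)
    ⌈(n : ℝ) / (ε / 6) ^ 2⌉₊ (Nat.le_ceil _)
  have hext0 : ∀ e, 0 ≤ ext c e := by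
    intro e
    simp only [ext]
    split_ifs
    · exact hc0 _
    · exact le_rfl
  have hlw : ∀ x, lapQ w x = ∑ e, (dotProduct (v e) x) ^ 2 := by
    intro x
    have := hlap (fun _ => 1) x
    simpa [hW1] using this
  have hw0 : ∀ x y, w x y = 0 → ext c (x, y) + ext c (y, x) = 0 := by
    intro x y h
    simp [ext, P, h, hsymm y x]
  refine ⟨W c, ?_, ?_, ?_, ?_, ?_, ?_⟩
  · intro x y
    simp only [W]
    rw [hsymm x y, add_comm]
  · intro x y
    exact mul_nonneg (add_nonneg (hext0 _) (hext0 _)) (hnn _ _)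
  · intro x y h
    exact right_ne_zero_of_mul h
  · intro x
    obtain ⟨h1, h2⟩ := hcx x
    rw [hlap, hlw]
    have hz : 0 ≤ ∑ e, (dotProduct (v e) x) ^ 2 := Finset.sum_nonneg fun _ _ => sq_nonneg _
    generalize ∑ e, (dotProduct (v e) x) ^ 2 = z at *
    generalize ∑ e, c e * (dotProduct (v e) x) ^ 2 = t at *
    constructor
    · rw [one_div_mul_eq_div, div_le_iff₀ (by linarith)]
      linarith
    · have h3 := mul_le_mul_of_nonneg_left h1 (by linarith : 0 ≤ 1 + ε)
      refine le_trans ?_ h3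
      have : 1 ≤ (1 + ε) * (1 - ε / 6) := by nlinarith
      nlinarith
  · have hcard : (Finset.univ.filter fun e : Fin n × Fin n =>
        e.1 < e.2 ∧ W c e.1 e.2 ≠ 0).card ≤ ⌈(n : ℝ) / (ε / 6) ^ 2⌉₊ := by
      refine le_trans (Finset.card_le_card (t := (Finset.univ.filter fun e => c e ≠ 0).map
        (Function.Embedding.subtype P)) ?_) (by rw [Finset.card_map]; exact hcT)
      rintro ⟨x, y⟩ he
      simp only [Finset.mem_filter, Finset.mem_univ, true_and] at he
      obtain ⟨hlt, hne⟩ := he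
      have hP : P (x, y) := ⟨hlt, right_ne_zero_of_mul hne⟩
      have h0 : ext c (y, x) = 0 := dif_neg fun h => absurd h.1 hlt.not_gt
      have h1 := left_ne_zero_of_mul hne
      rw [h0, add_zero] at h1
      have h2 : ext c (x, y) = c ⟨(x, y), hP⟩ := dif_pos hP
      rw [h2] at h1
      refine Finset.mem_map.mpr ⟨⟨(x, y), hP⟩, ?_, rfl⟩
      simpa using h1
    have h1 : ((Finset.univ.filter fun e : Fin n × Fin n =>
        e.1 < e.2 ∧ W c e.1 e.2 ≠ 0).card : ℝ) ≤ (n : ℝ) / (ε / 6) ^ 2 + 1 :=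
      le_trans (by exact_mod_cast hcard) (Nat.ceil_lt_add_one (by positivity)).le
    refine h1.trans ?_
    have h2 : (n : ℝ) / (ε / 6) ^ 2 = 36 * ε⁻¹ ^ 2 * n := by field_simp; norm_num
    have h3 : 1 ≤ ε⁻¹ := (one_le_inv₀ hε).2 (by linarith)
    have h4 : 1 ≤ ε⁻¹ ^ 2 * n :=
      one_le_mul_of_one_le_of_one_le (one_le_pow₀ h3) (by exact_mod_cast hn)
    have h5 : 1 ≤ Real.logb 2 ((n : ℝ) / p) ^ 34 := one_le_pow₀ hlog
    have h6 : 37 * ε⁻¹ ^ 2 * (n : ℝ) * 1 ≤ 37 * ε⁻¹ ^ 2 * (n : ℝ) *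
        Real.logb 2 ((n : ℝ) / p) ^ 34 := mul_le_mul_of_nonneg_left h5 (by positivity)
    refine le_trans ?_ h6
    rw [h2]; linarith
  · intro k
    have h1 : ∀ y, W c k y / w k y = ext c (k, y) + ext c (y, k) := by
      intro y
      simp only [W]
      by_cases h : w k y = 0
      · rw [hw0 k y h]; simp
      · rw [mul_div_assoc, div_self h, mul_one]
    simp only [h1]
    rw [hblow]
    have h2 := hck k
    have h3 : ∑ e, c e * b e k = 1 / d k * ∑ e, c e * F k e.1 := by
      rw [Finset.mul_sum]
      refine Finset.sum_congr rfl fun e _ => ?_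
      simp only [b]; ring
    rw [h3] at h2
    refine h2.trans ?_
    linarith
end
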